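/- arXiv:0912.0509 — 4 statements merged into one kernel-verified Lean document; each statement's English description precedes it below -/
import Mathlib

section
/- Hardy–Littlewood identity: for an integrable real random variable Z and a bounded real random variable X, ρ_Z(X) := sup { E[Z̃ X̃] : Z̃ ∼ Z, X̃ ∼ X } = ∫_0^1 F_X^{-1}(t) F_Z^{-1}(t) dt, where F_X^{-1}, F_Z^{-1} are the quantile functions (right-continuous generalized inverses of the distribution functions). -/
open MeasureTheory

/-- Maximal correlation functional. -/
noncomputable def maxCorr {Ω : Type*} [MeasurableSpace Ω] (μ : Measure Ω)
    (Z X : Ω → ℝ) : ℝ :=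
  sSup {r | ∃ Z' X' : Ω → ℝ, Measurable Z' ∧ Measurable X' ∧
    μ.map Z' = μ.map Z ∧ μ.map X' = μ.map X ∧ r = ∫ ω, Z' ω * X' ω ∂μ}

/-- Quantile function (generalized inverse of the cdf) of a law on ℝ. -/
noncomputable def quantileFn (ν : Measure ℝ) (t : ℝ) : ℝ :=
  sInf {x | t ≤ ProbabilityTheory.cdf ν x}

/-- Non-atomicity of a probability space. -/
def Nonatomic {Ω : Type*} [MeasurableSpace Ω] (μ : Measure Ω) : Prop :=
  ∀ s : Set Ω, MeasurableSet s → 0 < μ s →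
    ∃ t : Set Ω, MeasurableSet t ∧ t ⊆ s ∧ 0 < μ t ∧ μ t < μ s

open MeasureTheory Set Filter Topology ProbabilityTheory

/-- Uniform law on (0,1). -/
noncomputable def unifL : Measure ℝ := volume.restrict (Ioo 0 1)

instance : IsProbabilityMeasure unifL := ⟨by simp [unifL]⟩

lemma quantile_le_iff (ν : Measure ℝ) [IsProbabilityMeasure ν] {t x : ℝ} (ht : t ∈ Ioo (0:ℝ) 1) :
    quantileFn ν t ≤ x ↔ t ≤ cdf ν x := by
  have hne : {x | t ≤ cdf ν x}.Nonempty := by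
    have := (tendsto_cdf_atTop ν).eventually (eventually_ge_nhds ht.2)
    exact this.exists
  have hbdd : BddBelow {x | t ≤ cdf ν x} := by
    obtain ⟨y, hy⟩ := ((tendsto_cdf_atBot ν).eventually (eventually_lt_nhds ht.1)).exists
    refine ⟨y, fun z hz => ?_⟩
    by_contra h
    push Not at h
    exact absurd (hz.trans (monotone_cdf ν h.le)) (not_le.mpr hy)
  constructor
  · intro h
    have hr : Tendsto (cdf ν) (𝓝[>] x) (𝓝 (cdf ν x)) :=
      ((cdf ν).right_continuous x).mono Ioi_subset_Ici_self
    refine ge_of_tendsto hr ?_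
    filter_upwards [self_mem_nhdsWithin] with y hy
    obtain ⟨z, hz, hzy⟩ := exists_lt_of_csInf_lt hne (lt_of_le_of_lt h hy)
    exact le_trans hz (monotone_cdf ν hzy.le)
  · intro h
    exact csInf_le hbdd h

/-- Quantile function cut off outside (0,1). -/
noncomputable def qcut (ν : Measure ℝ) : ℝ → ℝ := (Ioo (0:ℝ) 1).indicator (quantileFn ν)

lemma qcut_le_iff (ν : Measure ℝ) [IsProbabilityMeasure ν] {t x : ℝ} (ht : t ∈ Ioo (0:ℝ) 1) :
    qcut ν t ≤ x ↔ t ≤ cdf ν x := by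
  rw [qcut, indicator_of_mem ht, quantile_le_iff ν ht]

lemma qcut_mono (ν : Measure ℝ) [IsProbabilityMeasure ν] : MonotoneOn (qcut ν) (Ioo 0 1) := by
  intro s hs t ht hst
  rw [qcut_le_iff ν hs]
  exact hst.trans ((qcut_le_iff ν ht).1 le_rfl)

lemma qcut_meas (ν : Measure ℝ) [IsProbabilityMeasure ν] : Measurable (qcut ν) := by
  refine measurable_of_restrict_of_restrict_compl (s := Ioo (0:ℝ) 1) measurableSet_Ioo ?_ ?_
  · have : Monotone ((Ioo (0:ℝ) 1).domRestrict (qcut ν)) := fun x y hxy => qcut_mono ν x.2 y.2 hxy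
    exact this.measurable
  · have : (Ioo (0:ℝ) 1)ᶜ.domRestrict (qcut ν) = fun _ => 0 := by
      ext x
      simp only [domRestrict_apply, qcut]
      exact indicator_of_notMem x.2 _
    rw [this]; exact measurable_const

lemma qcut_map (ν : Measure ℝ) [IsProbabilityMeasure ν] : unifL.map (qcut ν) = ν := by
  have := Measure.isProbabilityMeasure_map (μ := unifL) (qcut_meas ν).aemeasurable
  refine Measure.ext_of_Iic _ _ fun x => ?_
  rw [Measure.map_apply (qcut_meas ν) measurableSet_Iic, ← ofReal_cdf, unifL,
    Measure.restrict_apply (qcut_meas ν measurableSet_Iic)]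
  have h0 := cdf_nonneg ν x
  have h1 := cdf_le_one ν x
  have e : qcut ν ⁻¹' Iic x ∩ Ioo 0 1 = Iic (cdf ν x) ∩ Ioo 0 1 := by
    ext t
    simp only [mem_inter_iff, mem_preimage, mem_Iic, and_congr_left_iff]
    exact fun ht => qcut_le_iff ν ht
  rw [e]
  refine le_antisymm ?_ ?_
  · calc volume (Iic (cdf ν x) ∩ Ioo 0 1) ≤ volume (Ioc 0 (cdf ν x)) :=
          measure_mono fun t ht => ⟨ht.2.1, ht.1⟩
      _ = _ := by simp
  · calc ENNReal.ofReal (cdf ν x) = volume (Ioo 0 (cdf ν x)) := by simp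
      _ ≤ volume (Iic (cdf ν x) ∩ Ioo 0 1) := measure_mono fun t ht => ⟨ht.2.le, ht.1, ht.2.trans_le h1⟩

lemma cdf_map (ν : Measure ℝ) [IsProbabilityMeasure ν] (hν : ∀ x, ν {x} = 0) :
    ν.map (cdf ν) = unifL := by
  have hm : Measurable (cdf ν) := (monotone_cdf ν).measurable
  conv_lhs => rw [← qcut_map ν]
  rw [Measure.map_map (by rw [qcut_map]; exact hm) (qcut_meas ν), qcut_map]
  have : (cdf ν) ∘ (qcut ν) =ᵐ[unifL] id := by
    rw [EventuallyEq, unifL, ae_restrict_iff' measurableSet_Ioo]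
    refine Eventually.of_forall fun t ht => ?_
    refine le_antisymm ?_ ((qcut_le_iff ν ht).1 le_rfl)
    have h1 := StieltjesFunction.measure_singleton (cdf ν) (qcut ν t)
    rw [measure_cdf, hν] at h1
    have h2 : cdf ν (qcut ν t) ≤ Function.leftLim (cdf ν) (qcut ν t) := by
      have := ENNReal.ofReal_eq_zero.1 h1.symm
      linarith
    refine h2.trans ?_
    refine le_of_tendsto ((monotone_cdf ν).tendsto_leftLim (qcut ν t)) ?_
    filter_upwards [self_mem_nhdsWithin] with y hy
    by_contra h
    push Not at h
    exact absurd ((qcut_le_iff ν ht).2 h.le) (not_le.mpr hy)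
  rw [Measure.map_congr this, Measure.map_id]

section sier
variable {Ω : Type*} [MeasurableSpace Ω] (μ : Measure Ω) [IsProbabilityMeasure μ]

lemma exists_small (hna : Nonatomic μ) (s : Set Ω) (hs : MeasurableSet s) (hp : 0 < μ s) (n : ℕ) :
    ∃ t, MeasurableSet t ∧ t ⊆ s ∧ 0 < μ t ∧ 2 ^ n * μ t ≤ 1 := by
  induction n with
  | zero => exact ⟨s, hs, subset_rfl, hp, by simpa using prob_le_one⟩
  | succ n ih =>
    obtain ⟨t, ht, hts, htp, hle⟩ := ih
    obtain ⟨u, hu, hut, hup, hlt⟩ := hna t ht htp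
    have hadd : μ u + μ (t \ u) = μ t := by
      rw [← measure_inter_add_diff t hu, inter_eq_self_of_subset_right hut]
    rcases le_total (μ u) (μ (t \ u)) with h | h
    · refine ⟨u, hu, hut.trans hts, hup, ?_⟩
      calc 2 ^ (n+1) * μ u = 2 ^ n * (μ u + μ u) := by ring
        _ ≤ 2 ^ n * (μ u + μ (t \ u)) := by gcongr
        _ ≤ 1 := by rwa [hadd]
    · refine ⟨t \ u, ht.diff hu, diff_subset.trans hts, ?_, ?_⟩
      · rw [pos_iff_ne_zero]
        intro h0
        rw [h0, add_zero] at hadd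
        exact hlt.ne hadd
      · calc 2 ^ (n+1) * μ (t \ u) = 2 ^ n * (μ (t \ u) + μ (t \ u)) := by ring
          _ ≤ 2 ^ n * (μ u + μ (t \ u)) := by gcongr
          _ ≤ 1 := by rwa [hadd]

lemma exists_cover (hna : Nonatomic μ) (n : ℕ) :
    ∃ A : ℕ → Set Ω, (∀ k, MeasurableSet (A k) ∧ 2 ^ n * μ (A k) ≤ 1) ∧ μ (⋃ k, A k)ᶜ = 0 := by
  let S : Set ENNReal := {r | ∃ A : ℕ → Set Ω, (∀ k, MeasurableSet (A k) ∧ 2 ^ n * μ (A k) ≤ 1) ∧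
    r = μ (⋃ k, A k)}
  have hne : S.Nonempty := ⟨_, fun _ => ∅, by simp, rfl⟩
  obtain ⟨u, -, hu, huS⟩ := exists_seq_tendsto_sSup hne (OrderTop.bddAbove S)
  choose A hA hAu using huS
  let B : ℕ → Set Ω := fun k => A k.unpair.1 k.unpair.2
  have hB : ∀ k, MeasurableSet (B k) ∧ 2 ^ n * μ (B k) ≤ 1 := fun k => hA _ _
  have hsub : ∀ m, (⋃ k, A m k) ⊆ ⋃ k, B k := by
    intro m
    refine iUnion_subset fun k => ?_
    refine subset_trans ?_ (subset_iUnion B (Nat.pair m k))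
    simp [B]
  refine ⟨B, hB, ?_⟩
  by_contra h0
  have hBm : MeasurableSet (⋃ k, B k) := MeasurableSet.iUnion fun k => (hB k).1
  obtain ⟨t, ht, hts, htp, hle⟩ := exists_small μ hna _ hBm.compl (pos_iff_ne_zero.2 h0) n
  have hsup : sSup S ≤ μ (⋃ k, B k) := by
    refine le_of_tendsto' hu fun m => ?_
    rw [hAu]
    exact measure_mono (hsub m)
  let D : ℕ → Set Ω := fun k => Nat.casesOn k t B
  have hDS : μ (⋃ k, D k) ∈ S := by
    refine ⟨D, fun k => ?_, rfl⟩
    cases k with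
    | zero => exact ⟨ht, hle⟩
    | succ k => exact hB k
  have hDsub : (⋃ k, B k) ∪ t ⊆ ⋃ k, D k := by
    refine union_subset (iUnion_subset fun k => subset_iUnion D (k+1)) (subset_iUnion D 0)
  have hdisj : Disjoint (⋃ k, B k) t := (disjoint_compl_right).mono_right hts
  have h1 : μ (⋃ k, B k) + μ t ≤ μ (⋃ k, B k) := by
    rw [← measure_union hdisj ht]
    exact (measure_mono hDsub).trans ((le_sSup hDS).trans hsup)
  have h2 : μ (⋃ k, B k) < μ (⋃ k, B k) + μ t :=
    ENNReal.lt_add_right (measure_ne_top _ _) htp.ne'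
  exact absurd h1 (not_le.mpr h2)

lemma exists_unif (hna : Nonatomic μ) : ∃ U : Ω → ℝ, Measurable U ∧ μ.map U = unifL := by
  choose A hA hA0 using exists_cover μ hna
  obtain ⟨e, he⟩ := exists_measurableEmbedding_real (ℕ → ℕ → Prop)
  let g : Ω → ℕ → ℕ → Prop := fun ω n k => ω ∈ A n k
  have hg : Measurable g := by
    refine measurable_pi_lambda _ fun n => measurable_pi_lambda _ fun k => ?_
    exact measurable_mem.2 (hA n k).1
  have hf : Measurable (e ∘ g) := he.measurable.comp hg
  have hp := Measure.isProbabilityMeasure_map (μ := μ) hf.aemeasurable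
  have hat : ∀ x, μ.map (e ∘ g) {x} = 0 := by
    intro x
    rw [Measure.map_apply hf (measurableSet_singleton x)]
    by_contra h0
    have hsmall : ∀ n, 2 ^ n * μ ((e ∘ g) ⁻¹' {x}) ≤ 1 := by
      intro n
      have : ∃ ω ∈ (e ∘ g) ⁻¹' {x}, ω ∈ ⋃ k, A n k := by
        by_contra hcon
        push Not at hcon
        exact h0 (measure_mono_null hcon (hA0 n))
      obtain ⟨ω, hω, hωA⟩ := this
      obtain ⟨k, hk⟩ := mem_iUnion.1 hωA
      refine le_trans ?_ (hA n k).2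
      gcongr
      intro ω' hω'
      have : g ω' = g ω := he.injective ((hω' : e (g ω') = x).trans (hω : e (g ω) = x).symm)
      have h2 := congrFun (congrFun this n) k
      exact h2.mpr hk
    have hbig : ∀ n : ℕ, (n : ENNReal) * μ ((e ∘ g) ⁻¹' {x}) ≤ 1 := by
      intro n
      refine le_trans ?_ (hsmall n)
      gcongr
      exact_mod_cast (Nat.lt_two_pow_self (n := n)).le
    obtain ⟨n, hn⟩ := ENNReal.exists_nat_mul_gt h0 ENNReal.one_ne_top
    exact absurd (hbig n) (not_le.mpr hn)
  refine ⟨cdf (μ.map (e ∘ g)) ∘ (e ∘ g), (monotone_cdf _).measurable.comp hf, ?_⟩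
  rw [← Measure.map_map (monotone_cdf _).measurable hf]
  exact cdf_map _ hat

lemma fubini (Z X : Ω → ℝ) (hZ : Integrable Z μ) (hX : Measurable X) (C : ℝ)
    (hC : ∀ᵐ ω ∂μ, |X ω| ≤ C) :
    ∫ ω, Z ω * X ω ∂μ = -C * ∫ ω, Z ω ∂μ + ∫ s in Ioc (-C) C, ∫ ω in {ω | s < X ω}, Z ω ∂μ ∧
    Integrable (fun s => ∫ ω in {ω | s < X ω}, Z ω ∂μ) (volume.restrict (Ioc (-C) C)) := by
  let f : ℝ → Ω → ℝ := fun s ω => {ω | s < X ω}.indicator Z ω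
  have hms : ∀ s, MeasurableSet {ω | s < X ω} := fun s => measurableSet_lt measurable_const hX
  have hfi : Integrable (Function.uncurry f) ((volume.restrict (Ioc (-C) C)).prod μ) := by
    have h1 : Integrable (fun p : ℝ × Ω => Z p.2) ((volume.restrict (Ioc (-C) C)).prod μ) :=
      hZ.comp_snd _
    have : Function.uncurry f = {p : ℝ × Ω | p.1 < X p.2}.indicator (fun p : ℝ × Ω => Z p.2) := by
      ext p
      simp [f, Function.uncurry, indicator]
    rw [this]
    exact h1.indicator (measurableSet_lt measurable_fst (hX.comp measurable_snd))
  have e : ∀ s, ∫ ω in {ω | s < X ω}, Z ω ∂μ = ∫ ω, f s ω ∂μ := fun s =>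
    (integral_indicator (hms s)).symm
  simp_rw [e]
  refine ⟨?_, hfi.integral_prod_left⟩
  rw [integral_integral_swap hfi]
  have key : ∀ᵐ ω ∂μ, ∫ s in Ioc (-C) C, f s ω = Z ω * X ω + C * Z ω := by
    filter_upwards [hC] with ω hω
    have h1 : (fun s => f s ω) = (Iio (X ω)).indicator (fun _ => Z ω) := by
      ext s; simp [f, indicator]
    obtain ⟨hl, hr⟩ := abs_le.1 hω
    rw [h1, integral_indicator measurableSet_Iio, Measure.restrict_restrict measurableSet_Iio,
      setIntegral_const]
    have h2 : volume.real (Iio (X ω) ∩ Ioc (-C) C) = X ω + C := by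
      have : Iio (X ω) ∩ Ioc (-C) C = Ioo (-C) (X ω) := by
        ext s; simp only [mem_inter_iff, mem_Iio, mem_Ioc, mem_Ioo]
        constructor
        · rintro ⟨a, b, c⟩; exact ⟨b, a⟩
        · rintro ⟨a, b⟩; exact ⟨b, a, by linarith⟩
      rw [this, Real.volume_real_Ioo_of_le hl]; ring
    rw [h2, smul_eq_mul]; ring
  rw [integral_congr_ae key]
  have hZX : Integrable (fun ω => Z ω * X ω) μ :=
    hZ.mul_bdd hX.aestronglyMeasurable hC
  rw [integral_add hZX (hZ.const_mul C), integral_const_mul]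
  ring

lemma slice (Z : Ω → ℝ) (hZm : Measurable Z) (hZ : Integrable Z μ) (W : ℝ → ℝ) (hWm : Measurable W)
    (hlaw : μ.map Z = unifL.map W) (A : Set Ω) (hA : MeasurableSet A) (B : Set ℝ)
    (hB : MeasurableSet B) (hAB : μ A = unifL B)
    (hsep : ∀ t ∈ Bᶜ ∩ Ioo 0 1, ∀ t' ∈ B ∩ Ioo 0 1, W t ≤ W t') :
    ∫ ω in A, Z ω ∂μ ≤ ∫ t in B, W t ∂unifL := by
  have hid : ∀ h : ℝ → ℝ, Measurable h → ∫ ω, h (Z ω) ∂μ = ∫ t, h (W t) ∂unifL := by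
    intro h hh
    rw [← integral_map hZm.aemeasurable hh.aestronglyMeasurable, hlaw,
      integral_map hWm.aemeasurable hh.aestronglyMeasurable]
  have hW : Integrable W unifL := by
    have h1 : Integrable id (μ.map Z) :=
      (integrable_map_measure measurable_id.aestronglyMeasurable hZm.aemeasurable).2 hZ
    rw [hlaw] at h1
    exact (integrable_map_measure measurable_id.aestronglyMeasurable hWm.aemeasurable).1 h1
  rcases (B ∩ Ioo 0 1).eq_empty_or_nonempty with h | ⟨t1, ht1⟩
  · have hB0 : unifL B = 0 := by
      rw [unifL, Measure.restrict_apply hB, h, measure_empty]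
    rw [Measure.restrict_zero_set hB0, Measure.restrict_zero_set (hAB.trans hB0)]
    simp
  rcases (Bᶜ ∩ Ioo 0 1).eq_empty_or_nonempty with h | hne
  · have hB0 : unifL Bᶜ = 0 := by
      rw [unifL, Measure.restrict_apply hB.compl, h, measure_empty]
    have hA0 : μ Aᶜ = 0 := by
      rw [prob_compl_eq_one_sub hA, hAB, ← prob_compl_eq_one_sub hB, hB0]
    rw [Measure.restrict_eq_self_of_ae_mem (s := A) (mem_ae_iff.2 hA0),
      Measure.restrict_eq_self_of_ae_mem (s := B) (mem_ae_iff.2 hB0)]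
    exact (hid id measurable_id).le
  let c := sSup (W '' (Bᶜ ∩ Ioo 0 1))
  have hc1 : ∀ t ∈ Bᶜ ∩ Ioo 0 1, W t ≤ c := fun t ht =>
    le_csSup ⟨W t1, by rintro _ ⟨s, hs, rfl⟩; exact hsep s hs t1 ht1⟩ ⟨t, ht, rfl⟩
  have hc2 : ∀ t ∈ B ∩ Ioo 0 1, c ≤ W t := fun t ht =>
    csSup_le (hne.image W) (by rintro _ ⟨s, hs, rfl⟩; exact hsep s hs t ht)
  have hmax : Integrable (fun ω => max (Z ω - c) 0) μ := (hZ.sub (integrable_const c)).pos_part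
  have e1 : ∫ ω in A, Z ω ∂μ = ∫ ω in A, (Z ω - c) ∂μ + μ.real A * c := by
    rw [integral_sub hZ.integrableOn (integrable_const c)]
    simp
  have e2 : ∫ t in B, W t ∂unifL = ∫ t in B, (W t - c) ∂unifL + unifL.real B * c := by
    rw [integral_sub hW.integrableOn (integrable_const c)]
    simp
  have e3 : ∫ ω in A, (Z ω - c) ∂μ ≤ ∫ ω, max (Z ω - c) 0 ∂μ := by
    calc _ ≤ ∫ ω in A, max (Z ω - c) 0 ∂μ :=
          integral_mono (hZ.sub (integrable_const c)).integrableOn hmax.integrableOn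
            fun ω => le_max_left _ _
      _ ≤ _ := setIntegral_le_integral hmax (Eventually.of_forall fun ω => le_max_right _ _)
  have e4 : ∫ t in B, (W t - c) ∂unifL = ∫ t, max (W t - c) 0 ∂unifL := by
    rw [← integral_indicator hB]
    refine integral_congr_ae ?_
    rw [EventuallyEq, unifL, ae_restrict_iff' measurableSet_Ioo]
    refine Eventually.of_forall fun t ht => ?_
    by_cases htB : t ∈ B
    · rw [indicator_of_mem htB, max_eq_left (sub_nonneg.2 (hc2 t ⟨htB, ht⟩))]
    · rw [indicator_of_notMem htB, max_eq_right (sub_nonpos.2 (hc1 t ⟨htB, ht⟩))]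
  have e5 := hid (fun z => max (z - c) 0) (by fun_prop)
  have e6 : μ.real A = unifL.real B := by simp [measureReal_def, hAB]
  rw [e1, e2, e4, ← e5, e6]
  linarith

end sier

/-- Hardy–Littlewood identity for the maximal correlation functional. -/
theorem stmt5 {Ω : Type*} [MeasurableSpace Ω] (μ : Measure Ω) [IsProbabilityMeasure μ]
    (hna : Nonatomic μ) (Z X : Ω → ℝ)
    (hZm : Measurable Z) (hZi : Integrable Z μ)
    (hXm : Measurable X) (hXb : ∃ C, ∀ ω, |X ω| ≤ C) :
    maxCorr μ Z X = ∫ t in (0:ℝ)..1, quantileFn (μ.map X) t * quantileFn (μ.map Z) t := by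
  obtain ⟨C, hC⟩ := hXb
  have hpZ := Measure.isProbabilityMeasure_map (μ := μ) hZm.aemeasurable
  have hpX := Measure.isProbabilityMeasure_map (μ := μ) hXm.aemeasurable
  set QZ := qcut (μ.map Z) with hQZ
  set QX := qcut (μ.map X) with hQX
  have hQZm : Measurable QZ := qcut_meas _
  have hQXm : Measurable QX := qcut_meas _
  have lZ : unifL.map QZ = μ.map Z := qcut_map _
  have lX : unifL.map QX = μ.map X := qcut_map _
  have hR : ∫ t in (0:ℝ)..1, quantileFn (μ.map X) t * quantileFn (μ.map Z) t
      = ∫ t, QZ t * QX t ∂unifL := by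
    rw [intervalIntegral.integral_of_le zero_le_one, integral_Ioc_eq_integral_Ioo, unifL]
    refine setIntegral_congr_fun measurableSet_Ioo fun t ht => ?_
    simp only [hQZ, hQX, qcut, indicator_of_mem ht]
    ring
  have hbd : ∀ᵐ x ∂(μ.map X), |x| ≤ C := by
    rw [ae_map_iff hXm.aemeasurable (measurableSet_le (by fun_prop) (by fun_prop))]
    exact Eventually.of_forall hC
  have hIntZ : Integrable id (μ.map Z) :=
    (integrable_map_measure measurable_id.aestronglyMeasurable hZm.aemeasurable).2 hZi
  have hQZi : Integrable QZ unifL := by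
    rw [← lZ] at hIntZ
    exact (integrable_map_measure measurable_id.aestronglyMeasurable hQZm.aemeasurable).1 hIntZ
  have hQXb : ∀ᵐ t ∂unifL, |QX t| ≤ C := by
    rw [← lX] at hbd
    exact ae_of_ae_map hQXm.aemeasurable hbd
  rw [hR]
  obtain ⟨U, hU, hUl⟩ := exists_unif μ hna
  refine IsGreatest.csSup_eq ⟨⟨QZ ∘ U, QX ∘ U, hQZm.comp hU, hQXm.comp hU, ?_, ?_, ?_⟩, ?_⟩
  · rw [← Measure.map_map hQZm hU, hUl, lZ]
  · rw [← Measure.map_map hQXm hU, hUl, lX]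
  · rw [← hUl]
    exact integral_map hU.aemeasurable (hQZm.mul hQXm).aestronglyMeasurable
  · rintro r ⟨Z', X', hZ', hX', hZl, hXl, rfl⟩
    have hZi' : Integrable Z' μ := by
      rw [← hZl] at hIntZ
      exact (integrable_map_measure measurable_id.aestronglyMeasurable hZ'.aemeasurable).1 hIntZ
    have hXb' : ∀ᵐ ω ∂μ, |X' ω| ≤ C := by
      rw [← hXl] at hbd
      exact ae_of_ae_map hX'.aemeasurable hbd
    obtain ⟨a1, a2⟩ := fubini μ Z' X' hZi' hX' C hXb'
    obtain ⟨b1, b2⟩ := fubini unifL QZ QX hQZi hQXm C hQXb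
    have hE : ∫ ω, Z' ω ∂μ = ∫ t, QZ t ∂unifL := by
      have h1 := integral_map (μ := μ) hZ'.aemeasurable (f := id) measurable_id.aestronglyMeasurable
      have h2 := integral_map (μ := unifL) hQZm.aemeasurable (f := id)
        measurable_id.aestronglyMeasurable
      rw [hZl, ← lZ] at h1
      exact h1.symm.trans h2
    rw [a1, b1, hE]
    refine add_le_add le_rfl (integral_mono a2 b2 fun s => ?_)
    refine slice μ Z' hZ' hZi' QZ hQZm (hZl.trans lZ.symm) _
      (measurableSet_lt measurable_const hX') _ (measurableSet_lt measurable_const hQXm) ?_ ?_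
    · have h1 := Measure.map_apply (μ := μ) hX' (measurableSet_Ioi (a := s))
      have h2 := Measure.map_apply (μ := unifL) hQXm (measurableSet_Ioi (a := s))
      rw [hXl, ← lX] at h1
      exact h1.symm.trans h2
    · rintro t ⟨ht, htI⟩ t' ⟨ht', htI'⟩
      refine qcut_mono _ htI htI' ?_
      by_contra h
      push Not at h
      have h3 : QX t' ≤ QX t := qcut_mono _ htI' htI h.le
      exact ht (lt_of_lt_of_le (show s < QX t' from ht') h3)
end

section
/- Let X₁, ..., X_p be bounded real random variables on a non-atomic probability space. The following are equivalent: (1) (X₁,...,X_p) is comonotone; (2) for every non-atomic integrable real random variable Z, ρ_Z(Σᵢ Xᵢ) = Σᵢ ρ_Z(Xᵢ); (3) there exists a non-atomic integrable Z with ρ_Z(Σᵢ Xᵢ) = Σᵢ ρ_Z(Xᵢ). -/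
open MeasureTheory

/-- Comonotonicity of a pair of real random variables. -/
def Comonotone {Ω : Type*} [MeasurableSpace Ω] (μ : Measure Ω) (X Y : Ω → ℝ) : Prop :=
  ∀ᵐ q ∂(μ.prod μ), 0 ≤ (X q.1 - X q.2) * (Y q.1 - Y q.2)

open Filter Set

lemma na_small {Ω : Type*} [MeasurableSpace Ω] (μ : Measure Ω) [IsProbabilityMeasure μ]
    (hna : Nonatomic μ) (n : ℕ) (s : Set Ω) (hs : MeasurableSet s) (h0 : 0 < μ s) :
    ∃ t, MeasurableSet t ∧ t ⊆ s ∧ 0 < μ t ∧ μ.real t ≤ (1/2)^n := by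
  induction n with
  | zero => exact ⟨s, hs, subset_rfl, h0, by simp⟩
  | succ n ih =>
    obtain ⟨t, ht, hts, ht0, htn⟩ := ih
    obtain ⟨u, hu, hut, hu0, hult⟩ := hna t ht ht0
    have hd : μ.real (t \ u) = μ.real t - μ.real u := measureReal_sdiff hut hu
    by_cases hc : μ.real u ≤ (1/2)^(n+1)
    · exact ⟨u, hu, hut.trans hts, hu0, hc⟩
    · refine ⟨t \ u, ht.diff hu, sdiff_subset.trans hts, ?_, ?_⟩
      · rw [measure_sdiff hut hu.nullMeasurableSet (measure_ne_top _ _)]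
        exact tsub_pos_of_lt hult
      · rw [hd]; rw [pow_succ] at *; linarith

lemma na_cover {Ω : Type*} [MeasurableSpace Ω] (μ : Measure Ω) [IsProbabilityMeasure μ]
    (hna : Nonatomic μ) (k : ℕ) :
    ∃ B : ℕ → Set Ω, (∀ n, MeasurableSet (B n)) ∧ (∀ n, μ.real (B n) ≤ (1/2)^k) ∧
      μ (⋃ n, B n)ᶜ = 0 := by
  let D : Set (Set Ω) := {G | ∃ B : ℕ → Set Ω, (∀ n, MeasurableSet (B n)) ∧
    (∀ n, μ.real (B n) ≤ (1/2)^k) ∧ G = ⋃ n, B n}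
  have hne : (μ '' D).Nonempty := ⟨_, mem_image_of_mem _ ⟨fun _ => ∅, by simp, by simp, rfl⟩⟩
  obtain ⟨u, -, hu, huD⟩ := exists_seq_tendsto_sSup hne (OrderTop.bddAbove _)
  choose G hGD hGu using huD
  choose B hBm hBs hBG using hGD
  have key : (⋃ j, G j) = ⋃ n, B (Nat.unpair n).1 (Nat.unpair n).2 := by
    ext x
    simp only [hBG, mem_iUnion]
    constructor
    · rintro ⟨i, j, h⟩
      exact ⟨Nat.pair i j, by simpa using h⟩
    · rintro ⟨n, h⟩
      exact ⟨_, _, h⟩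
  refine ⟨fun n => B (Nat.unpair n).1 (Nat.unpair n).2, fun n => hBm _ _, fun n => hBs _ _, ?_⟩
  rw [← key]
  have hGm : MeasurableSet (⋃ j, G j) := by
    rw [key]; exact MeasurableSet.iUnion fun n => hBm _ _
  have hge : sSup (μ '' D) ≤ μ (⋃ j, G j) :=
    le_of_tendsto' hu fun n => by
      rw [← hGu]; exact measure_mono (subset_iUnion _ n)
  by_contra hcon
  obtain ⟨t, ht, hts, ht0, htk⟩ := na_small μ hna k _ hGm.compl (pos_iff_ne_zero.2 hcon)
  have hmem : (t ∪ ⋃ j, G j) ∈ D := by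
    refine ⟨fun n => Nat.casesOn n t fun n => B (Nat.unpair n).1 (Nat.unpair n).2, ?_, ?_, ?_⟩
    · rintro (_ | n); exacts [ht, hBm _ _]
    · rintro (_ | n); exacts [htk, hBs _ _]
    · rw [key]; ext x; simp only [mem_union, mem_iUnion]
      constructor
      · rintro (h | ⟨n, h⟩)
        exacts [⟨0, h⟩, ⟨n+1, h⟩]
      · rintro ⟨_ | n, h⟩
        exacts [Or.inl h, Or.inr ⟨n, h⟩]
  have h1 : μ (t ∪ ⋃ j, G j) ≤ sSup (μ '' D) := le_sSup (mem_image_of_mem _ hmem)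
  rw [measure_union (disjoint_left.2 fun x hx h => hts hx h) hGm] at h1
  have h2 := h1.trans hge
  have h3 : μ (⋃ j, G j) < μ t + μ (⋃ j, G j) := by
    rw [add_comm]
    exact ENNReal.lt_add_right (measure_ne_top _ _) ht0.ne'
  exact absurd h2 (not_le.2 h3)

lemma na_exists {Ω : Type*} [MeasurableSpace Ω] (μ : Measure Ω) [IsProbabilityMeasure μ]
    (hna : Nonatomic μ) :
    ∃ V : Ω → ℝ, Measurable V ∧ (∀ ω, V ω ∈ Icc (0:ℝ) 1) ∧ ∀ a, μ (V ⁻¹' {a}) = 0 := by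
  classical
  choose B hBm hBs hB0 using na_cover μ hna
  let f : Ω → (ℕ × ℕ → Bool) := fun ω q => decide (ω ∈ B q.1 q.2)
  have hf : Measurable f := by
    refine measurable_pi_iff.2 fun q => ?_
    exact (measurable_to_bool (by
      have : (fun ω => f ω q) ⁻¹' {true} = B q.1 q.2 := by ext; simp [f]
      rw [this]; exact hBm _ _))
  let e := embeddingReal (ℕ × ℕ → Bool)
  have he : MeasurableEmbedding e := measurableEmbedding_embeddingReal _
  refine ⟨fun ω => Real.sigmoid (e (f ω)), ?_, ?_, ?_⟩
  · exact (by fun_prop : Measurable Real.sigmoid).comp (he.measurable.comp hf)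
  · exact fun ω => ⟨(Real.sigmoid_pos _).le, (Real.sigmoid_lt_one _).le⟩
  intro a
  have hle : ∀ k : ℕ, μ.real ((fun ω => Real.sigmoid (e (f ω))) ⁻¹' {a}) ≤ (1/2)^k := by
    intro k
    by_cases h : ∃ ω n, Real.sigmoid (e (f ω)) = a ∧ ω ∈ B k n
    · obtain ⟨ω, n, hω, hn⟩ := h
      refine (measureReal_mono ?_).trans (hBs k n)
      intro ω' hω'
      have h1 : Real.sigmoid (e (f ω')) = Real.sigmoid (e (f ω)) := by rw [hω]; exact hω'
      have h2 := congrFun (he.injective (Real.sigmoid_injective h1)) (k, n)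
      simpa [f, hn] using h2
    · push Not at h
      have : μ ((fun ω => Real.sigmoid (e (f ω))) ⁻¹' {a}) = 0 := by
        refine measure_mono_null ?_ (hB0 k)
        intro ω hω
        simp only [mem_compl_iff, mem_iUnion, not_exists]
        exact fun n => h ω n hω
      rw [measureReal_def, this]; simp
  have h0 : μ.real ((fun ω => Real.sigmoid (e (f ω))) ⁻¹' {a}) ≤ 0 :=
    ge_of_tendsto' (tendsto_pow_atTop_nhds_zero_of_lt_one (by norm_num) (by norm_num)) hle
  exact (measureReal_eq_zero_iff).1 (le_antisymm h0 measureReal_nonneg)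

lemma refine_W {Ω : Type*} [MeasurableSpace Ω] (μ : Measure Ω) [IsProbabilityMeasure μ]
    (hna : Nonatomic μ) (S : Ω → ℝ) (hS : Measurable S) :
    ∃ W : Ω → ℝ, Measurable W ∧ (∀ a, μ (W ⁻¹' {a}) = 0) ∧
      ∀ ω ω', W ω ≤ W ω' → S ω ≤ S ω' := by
  obtain ⟨V, hV, hV01, hV0⟩ := na_exists μ hna
  let L : ℝ → ℝ := fun s => μ.real (S ⁻¹' Iio s)
  let M : ℝ → ℝ := fun s => μ.real (S ⁻¹' Iic s)
  have hL : Monotone L := fun a b h => measureReal_mono (preimage_mono (Iio_subset_Iio h))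
  have hM : Monotone M := fun a b h => measureReal_mono (preimage_mono (Iic_subset_Iic.2 h))
  have hLM : ∀ s, L s ≤ M s := fun s => measureReal_mono (preimage_mono Iio_subset_Iic_self)
  have hML : ∀ s t, s < t → M s ≤ L t := fun s t h =>
    measureReal_mono (preimage_mono (Iic_subset_Iio.2 h))
  have hat : ∀ s, M s - L s = μ.real (S ⁻¹' {s}) := by
    intro s
    have : S ⁻¹' {s} = (S ⁻¹' Iic s) \ (S ⁻¹' Iio s) := by
      ext x; simp [le_antisymm_iff]
    rw [this, measureReal_sdiff (preimage_mono Iio_subset_Iic_self) (hS measurableSet_Iio)]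
  let W : Ω → ℝ := fun ω => S ω + (L (S ω) + (M (S ω) - L (S ω)) * V ω)
  have hlt : ∀ ω ω', S ω < S ω' → W ω < W ω' := by
    intro ω ω' h
    have h1 := hML _ _ h
    have h2 := hLM (S ω)
    have h3 := hLM (S ω')
    have h4 := hV01 ω
    have h5 := hV01 ω'
    have h6 : (M (S ω) - L (S ω)) * V ω ≤ (M (S ω) - L (S ω)) * 1 :=
      mul_le_mul_of_nonneg_left h4.2 (by linarith)
    have h7 : 0 ≤ (M (S ω') - L (S ω')) * V ω' := mul_nonneg (by linarith) h5.1
    simp only [W]; linarith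
  refine ⟨W, ?_, ?_, fun ω ω' h => not_lt.1 fun h' => absurd (hlt _ _ h') (not_lt.2 h)⟩
  · exact hS.add ((hL.measurable.comp hS).add
      (((hM.measurable.comp hS).sub (hL.measurable.comp hS)).mul hV))
  intro a
  by_cases hne : ∃ ω, W ω = a
  swap
  · push Not at hne
    have : W ⁻¹' {a} = ∅ := by ext x; simpa using hne x
    rw [this]; simp
  obtain ⟨ω₀, h0⟩ := hne
  have hSeq : ∀ ω, W ω = a → S ω = S ω₀ := by
    intro ω h
    rcases lt_trichotomy (S ω) (S ω₀) with h' | h' | h'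
    · have := hlt _ _ h'; linarith
    · exact h'
    · have := hlt _ _ h'; linarith
  by_cases hz : M (S ω₀) - L (S ω₀) = 0
  · rw [hat, measureReal_eq_zero_iff] at hz
    exact measure_mono_null (fun ω h => hSeq ω h) hz
  · refine measure_mono_null (fun ω h => ?_) (hV0 (V ω₀))
    have h1 := hSeq ω h
    have h2 : W ω = W ω₀ := by rw [h0]; exact h
    simp only [W, h1] at h2
    have h3 : (M (S ω₀) - L (S ω₀)) * V ω = (M (S ω₀) - L (S ω₀)) * V ω₀ := by linarith
    exact mul_left_cancel₀ hz h3

open ProbabilityTheory in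
lemma pit {Ω : Type*} [MeasurableSpace Ω] (μ : Measure Ω) [IsProbabilityMeasure μ]
    (W : Ω → ℝ) (hW : Measurable W) (h0 : ∀ a, μ (W ⁻¹' {a}) = 0) (u : ℝ) (hu0 : 0 ≤ u)
    (hu1 : u ≤ 1) : μ.real {ω | cdf (μ.map W) (W ω) ≤ u} = u := by
  have : IsProbabilityMeasure (μ.map W) := Measure.isProbabilityMeasure_map hW.aemeasurable
  set F := cdf (μ.map W) with hF
  have hFreal : ∀ w, F w = μ.real (W ⁻¹' Iic w) := by
    intro w
    rw [hF, cdf_eq_real, map_measureReal_apply hW measurableSet_Iic]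
  have hcont : Continuous F := by
    rw [continuous_iff_continuousAt]
    intro a
    rw [F.mono.continuousAt_iff_leftLim_eq_rightLim, F.rightLim_eq]
    have h1 : F.measure {a} = 0 := by
      rw [hF, measure_cdf, Measure.map_apply hW (measurableSet_singleton _), h0]
    rw [StieltjesFunction.measure_singleton, ENNReal.ofReal_eq_zero] at h1
    exact le_antisymm (F.mono.leftLim_le le_rfl) (by linarith)
  rcases hu1.eq_or_lt with rfl | hu1
  · have : {ω | F (W ω) ≤ 1} = univ := by ext ω; simp [hF, cdf_le_one]
    rw [this]; simp
  by_cases hne : ∃ w, F w ≤ u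
  swap
  · push Not at hne
    have h1 : {ω | F (W ω) ≤ u} = ∅ := by ext ω; simpa using hne _
    have h2 : u ≤ 0 := ge_of_tendsto' (tendsto_cdf_atBot (μ.map W)) fun w => (hne w).le
    rw [h1]; simp; linarith
  obtain ⟨b, hb⟩ := ((tendsto_order.1 (tendsto_cdf_atTop (μ.map W))).1 u hu1).exists
  let A : Set ℝ := {w | F w ≤ u}
  have hAb : BddAbove A := ⟨b, fun w hw => le_of_lt (F.mono.reflect_lt (lt_of_le_of_lt hw hb))⟩
  have hAc : IsClosed A := isClosed_le hcont continuous_const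
  have hmem : sSup A ∈ A := hAc.csSup_mem hne hAb
  have heq : F (sSup A) = u := by
    refine le_antisymm hmem ?_
    have hr : Tendsto F (nhdsWithin (sSup A) (Ioi (sSup A))) (nhds (F (sSup A))) :=
      (hcont.tendsto _).mono_left nhdsWithin_le_nhds
    refine ge_of_tendsto hr ?_
    filter_upwards [self_mem_nhdsWithin] with w hw
    by_contra hcon
    exact absurd (le_csSup hAb (not_le.1 hcon).le) (not_le.2 hw)
  have hset : {ω | F (W ω) ≤ u} = W ⁻¹' Iic (sSup A) := by
    ext ω
    exact ⟨fun h => le_csSup hAb h, fun h => (F.mono h).trans hmem⟩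
  rw [hset, ← hFreal, heq]

open ProbabilityTheory in
lemma transport {Ω : Type*} [MeasurableSpace Ω] (μ : Measure Ω) [IsProbabilityMeasure μ]
    (W : Ω → ℝ) (hW : Measurable W) (h0 : ∀ a, μ (W ⁻¹' {a}) = 0)
    (ν : Measure ℝ) [IsProbabilityMeasure ν] :
    ∃ Z : Ω → ℝ, Measurable Z ∧ μ.map Z = ν ∧ ∃ E : Set Ω, (∀ᵐ ω ∂μ, ω ∈ E) ∧
      ∀ ω ∈ E, ∀ ω' ∈ E, W ω ≤ W ω' → Z ω ≤ Z ω' := by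
  classical
  set F := cdf (μ.map W) with hF
  set G := cdf ν with hG
  have hUm : Measurable fun ω => F (W ω) := F.mono.measurable.comp hW
  have hpit := pit μ W hW h0
  rw [← hF] at hpit
  let E : Set Ω := {ω | 0 < F (W ω) ∧ F (W ω) < 1}
  have hEm : MeasurableSet E :=
    (measurableSet_lt measurable_const hUm).inter (measurableSet_lt hUm measurable_const)
  have hE : ∀ᵐ ω ∂μ, ω ∈ E := by
    have h1 : ∀ᵐ ω ∂μ, 0 < F (W ω) := by
      have := hpit 0 le_rfl zero_le_one
      rw [measureReal_eq_zero_iff] at this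
      rw [ae_iff]; simpa using this
    have h2 : ∀ᵐ ω ∂μ, F (W ω) < 1 := by
      have hm : MeasurableSet {ω | F (W ω) < 1} := measurableSet_lt hUm measurable_const
      have : 1 ≤ μ.real {ω | F (W ω) < 1} := by
        refine le_of_forall_lt fun c hc => ?_
        have hc' : max c 0 < 1 := max_lt hc one_pos
        obtain ⟨d, hd, hd1⟩ := exists_between hc'
        have h3 := hpit d ((le_max_right _ _).trans hd.le) hd1.le
        have h4 : μ.real {ω | F (W ω) ≤ d} ≤ μ.real {ω | F (W ω) < 1} :=
          measureReal_mono fun ω h => lt_of_le_of_lt h hd1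
        linarith [le_max_left c 0]
      have h5 : μ.real {ω | F (W ω) < 1}ᶜ = 0 := by
        rw [probReal_compl_eq_one_sub hm]
        have : μ.real {ω | F (W ω) < 1} ≤ 1 := measureReal_le_one
        linarith
      rw [measureReal_eq_zero_iff] at h5
      exact h5
    filter_upwards [h1, h2] with ω a b using ⟨a, b⟩
  let Q : ℝ → ℝ := fun u => sInf {z | u ≤ G z}
  have hbdd : ∀ u, 0 < u → BddBelow {z | u ≤ G z} := by
    intro u hu
    obtain ⟨b, hb⟩ := ((tendsto_order.1 (tendsto_cdf_atBot ν)).2 u hu).exists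
    exact ⟨b, fun z hz => le_of_lt (G.mono.reflect_lt (lt_of_lt_of_le hb hz))⟩
  have hnon : ∀ u, u < 1 → {z | u ≤ G z}.Nonempty := by
    intro u hu
    obtain ⟨b, hb⟩ := ((tendsto_order.1 (tendsto_cdf_atTop ν)).1 u hu).exists
    exact ⟨b, hb.le⟩
  have hQ : ∀ u, 0 < u → u < 1 → ∀ z, Q u ≤ z ↔ u ≤ G z := by
    intro u hu0 hu1 z
    refine ⟨fun h => ?_, fun h => csInf_le (hbdd u hu0) h⟩
    have hr : Tendsto G (nhdsWithin z (Ioi z)) (nhds (G z)) :=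
      (G.right_continuous z).tendsto.mono_left (nhdsWithin_mono _ Ioi_subset_Ici_self)
    refine ge_of_tendsto hr ?_
    filter_upwards [self_mem_nhdsWithin] with w hw
    obtain ⟨y, hy, hyw⟩ := exists_lt_of_csInf_lt (hnon u hu1) (lt_of_le_of_lt h hw)
    exact le_trans hy (G.mono hyw.le)
  let Z : Ω → ℝ := fun ω => if ω ∈ E then Q (F (W ω)) else 0
  have hZE : ∀ ω ∈ E, ∀ z, Z ω ≤ z ↔ F (W ω) ≤ G z := by
    intro ω hω z
    simp only [Z, hω, if_true]
    exact hQ _ hω.1 hω.2 z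
  have hZm : Measurable Z := by
    refine measurable_of_Iic fun z => ?_
    have : Z ⁻¹' Iic z = (E ∩ {ω | F (W ω) ≤ G z}) ∪ (Eᶜ ∩ {ω | 0 ≤ z}) := by
      ext ω
      by_cases h : ω ∈ E
      · simp [h, hZE ω h]
      · simp [h, Z]
    rw [this]
    exact (hEm.inter (measurableSet_le hUm measurable_const)).union
      (hEm.compl.inter (MeasurableSet.const _))
  refine ⟨Z, hZm, ?_, E, hE, ?_⟩
  · have : IsProbabilityMeasure (μ.map Z) := Measure.isProbabilityMeasure_map hZm.aemeasurable
    refine Measure.eq_of_cdf _ _ ?_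
    ext z
    rw [cdf_eq_real, map_measureReal_apply hZm measurableSet_Iic,
      ← hG, ← hpit (G z) (cdf_nonneg _ _) (cdf_le_one _ _)]
    refine measureReal_congr ?_
    filter_upwards [hE] with ω hω
    exact propext (hZE ω hω z)
  · intro ω hω ω' hω' h
    rw [hZE ω hω]
    exact (F.mono h).trans ((hZE ω' hω' _).1 le_rfl)

/-- Existence of a comonotone copy. -/
lemma exists_comon {Ω : Type*} [MeasurableSpace Ω] (μ : Measure Ω) [IsProbabilityMeasure μ]
    (hna : Nonatomic μ) (S Z : Ω → ℝ) (hS : Measurable S) (hZ : Measurable Z) :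
    ∃ Z' : Ω → ℝ, Measurable Z' ∧ μ.map Z' = μ.map Z ∧ Comonotone μ Z' S := by
  obtain ⟨W, hW, hW0, hWS⟩ := refine_W μ hna S hS
  have : IsProbabilityMeasure (μ.map Z) := Measure.isProbabilityMeasure_map hZ.aemeasurable
  obtain ⟨Z', hZ', hmap, E, hE, hmono⟩ := transport μ W hW hW0 (μ.map Z)
  refine ⟨Z', hZ', hmap, ?_⟩
  have h1 : ∀ᵐ q ∂(μ.prod μ), q.1 ∈ E := Measure.quasiMeasurePreserving_fst.ae hE
  have h2 : ∀ᵐ q ∂(μ.prod μ), q.2 ∈ E := Measure.quasiMeasurePreserving_snd.ae hE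
  filter_upwards [h1, h2] with q h1 h2
  rcases le_total (W q.1) (W q.2) with h | h
  · exact mul_nonneg_of_nonpos_of_nonpos (by linarith [hmono _ h1 _ h2 h])
      (by linarith [hWS _ _ h])
  · exact mul_nonneg (by linarith [hmono _ h2 _ h1 h]) (by linarith [hWS _ _ h])

/-- `Z` is comonotone with the indicator of `A`. -/
def CoSet {Ω : Type*} [MeasurableSpace Ω] (μ : Measure Ω) (Z : Ω → ℝ) (A : Set Ω) : Prop :=
  ∀ᵐ q ∂(μ.prod μ), q.1 ∈ A → q.2 ∉ A → Z q.2 ≤ Z q.1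

lemma coSet_of_threshold {Ω : Type*} [MeasurableSpace Ω] (μ : Measure Ω) [IsProbabilityMeasure μ]
    (Z : Ω → ℝ) (A : Set Ω) (c : ℝ) (h : ∀ᵐ ω ∂μ, (ω ∈ A → c ≤ Z ω) ∧ (ω ∉ A → Z ω ≤ c)) :
    CoSet μ Z A := by
  have h1 := Measure.quasiMeasurePreserving_fst (μ := μ) (ν := μ) |>.ae h
  have h2 := Measure.quasiMeasurePreserving_snd (μ := μ) (ν := μ) |>.ae h
  filter_upwards [h1, h2] with q h1 h2 ha hb
  exact (h2.2 hb).trans (h1.1 ha)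

lemma coSet_null {Ω : Type*} [MeasurableSpace Ω] (μ : Measure Ω) [IsProbabilityMeasure μ]
    (Z : Ω → ℝ) (A : Set Ω) (h : μ A = 0) : CoSet μ Z A := by
  have h' : ∀ᵐ ω ∂μ, ω ∉ A := measure_eq_zero_iff_ae_notMem.1 h
  have h1 := Measure.quasiMeasurePreserving_fst (μ := μ) (ν := μ) |>.ae h'
  filter_upwards [h1] with q h1 ha hb
  exact absurd ha h1

lemma coSet_full {Ω : Type*} [MeasurableSpace Ω] (μ : Measure Ω) [IsProbabilityMeasure μ]
    (Z : Ω → ℝ) (A : Set Ω) (h : μ Aᶜ = 0) : CoSet μ Z A := by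
  have h' : ∀ᵐ ω ∂μ, ω ∈ A := h
  have h1 := Measure.quasiMeasurePreserving_snd (μ := μ) (ν := μ) |>.ae h'
  filter_upwards [h1] with q h1 ha hb
  exact absurd h1 hb

lemma threshold_of_coSet {Ω : Type*} [MeasurableSpace Ω] (μ : Measure Ω) [IsProbabilityMeasure μ]
    (Z : Ω → ℝ) (A : Set Ω) (hA0 : μ A ≠ 0) (hA1 : μ Aᶜ ≠ 0)
    (h : CoSet μ Z A) :
    ∃ c, ∀ᵐ ω ∂μ, (ω ∈ A → c ≤ Z ω) ∧ (ω ∉ A → Z ω ≤ c) := by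
  let R : Set ℝ := {r | ∀ᵐ ω ∂μ, ω ∈ A → r ≤ Z ω}
  have hsw : ∀ᵐ ω' ∂μ, ω' ∉ A → Z ω' ∈ R := by
    have h1 : ∀ᵐ q ∂(μ.prod μ), q.2 ∈ A → q.1 ∉ A → Z q.1 ≤ Z q.2 :=
      (Measure.measurePreserving_swap (μ := μ) (ν := μ)).quasiMeasurePreserving.ae h
    filter_upwards [Measure.ae_ae_of_ae_prod h1] with ω' hω' hn
    filter_upwards [hω'] with ω hω ha using hω ha hn
  have hne : R.Nonempty := by
    by_contra hcon
    rw [not_nonempty_iff_eq_empty] at hcon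
    refine hA1 ?_
    rw [measure_eq_zero_iff_ae_notMem]
    filter_upwards [hsw] with ω hω hn
    have := hω hn
    rw [hcon] at this; exact this
  have hbd : BddAbove R := by
    by_contra hcon
    refine hA0 ?_
    rw [measure_eq_zero_iff_ae_notMem]
    have h2 : ∀ n : ℕ, ∀ᵐ ω ∂μ, ω ∈ A → (n:ℝ) ≤ Z ω := by
      intro n
      obtain ⟨r, hr, hnr⟩ := not_bddAbove_iff.1 hcon n
      filter_upwards [hr] with ω hω ha using hnr.le.trans (hω ha)
    filter_upwards [ae_all_iff.2 h2] with ω hω ha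
    obtain ⟨n, hn⟩ := exists_nat_gt (Z ω)
    exact absurd (hω n ha) (not_le.2 hn)
  refine ⟨sSup R, ?_⟩
  obtain ⟨u, -, hu, huR⟩ := exists_seq_tendsto_sSup hne hbd
  have h3 : ∀ᵐ ω ∂μ, ∀ n, ω ∈ A → u n ≤ Z ω := ae_all_iff.2 huR
  filter_upwards [hsw, h3] with ω h1 h2
  exact ⟨fun ha => le_of_tendsto' hu fun n => h2 n ha, fun hn => le_csSup hbd (h1 hn)⟩

lemma coSet_main {Ω : Type*} [MeasurableSpace Ω] (μ : Measure Ω) [IsProbabilityMeasure μ]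
    (Z Z' : Ω → ℝ) (hZ : Measurable Z) (hZ' : Measurable Z') (hi : Integrable Z μ)
    (hi' : Integrable Z' μ) (hmap : μ.map Z' = μ.map Z)
    (A B : Set Ω) (hA : MeasurableSet A) (hB : MeasurableSet B) (hAB : μ B = μ A)
    (h : CoSet μ Z A) :
    ∫ ω in B, Z' ω ∂μ ≤ ∫ ω in A, Z ω ∂μ ∧
      (∫ ω in B, Z' ω ∂μ = ∫ ω in A, Z ω ∂μ → CoSet μ Z' B) := by
  by_cases hA0 : μ A = 0
  · have hB0 : μ B = 0 := hAB.trans hA0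
    rw [setIntegral_measure_zero _ hA0, setIntegral_measure_zero _ hB0]
    exact ⟨le_rfl, fun _ => coSet_null μ Z' B hB0⟩
  have hint : ∀ f : ℝ → ℝ, Measurable f → ∫ ω, f (Z' ω) ∂μ = ∫ ω, f (Z ω) ∂μ := by
    intro f hf
    rw [← integral_map hZ'.aemeasurable hf.aestronglyMeasurable,
      ← integral_map hZ.aemeasurable hf.aestronglyMeasurable, hmap]
  by_cases hA1 : μ Aᶜ = 0
  · have hB1 : μ Bᶜ = 0 := by
      rw [measure_compl hB (measure_ne_top _ _), hAB, ← measure_compl hA (measure_ne_top _ _), hA1]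
    have e1 : ∫ ω in B, Z' ω ∂μ = ∫ ω, Z' ω ∂μ := by
      rw [← integral_add_compl hB hi', setIntegral_measure_zero _ hB1, add_zero]
    have e2 : ∫ ω in A, Z ω ∂μ = ∫ ω, Z ω ∂μ := by
      rw [← integral_add_compl hA hi, setIntegral_measure_zero _ hA1, add_zero]
    rw [e1, e2]
    exact ⟨(hint id measurable_id).le, fun _ => coSet_full μ Z' B hB1⟩
  obtain ⟨c, hc⟩ := threshold_of_coSet μ Z A hA0 hA1 h
  have hp : Integrable (fun ω => max (Z ω - c) 0) μ := (hi.sub (integrable_const c)).pos_part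
  have hp' : Integrable (fun ω => max (Z' ω - c) 0) μ := (hi'.sub (integrable_const c)).pos_part
  have hpe : ∫ ω, max (Z' ω - c) 0 ∂μ = ∫ ω, max (Z ω - c) 0 ∂μ :=
    hint (fun z => max (z - c) 0) (by fun_prop)
  have hq : ∀ (Y : Ω → ℝ) (D : Set Ω), Integrable Y μ → MeasurableSet D →
      Integrable (D.indicator fun ω => Y ω - c) μ ∧
      ∫ ω, D.indicator (fun ω => Y ω - c) ω ∂μ = ∫ ω in D, Y ω ∂μ - μ.real D * c := by
    intro Y D hY hD
    refine ⟨(hY.sub (integrable_const c)).indicator hD, ?_⟩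
    rw [integral_indicator hD, integral_sub hY.integrableOn (integrable_const c).integrableOn]
    simp
  obtain ⟨iA, eA⟩ := hq Z A hi hA
  obtain ⟨iB, eB⟩ := hq Z' B hi' hB
  have hr : μ.real B = μ.real A := by rw [measureReal_def, hAB, measureReal_def]
  have hZA : ∫ ω, A.indicator (fun ω => Z ω - c) ω ∂μ = ∫ ω, max (Z ω - c) 0 ∂μ := by
    refine integral_congr_ae ?_
    filter_upwards [hc] with ω hω
    by_cases ha : ω ∈ A
    · rw [indicator_of_mem ha, max_eq_left (by linarith [hω.1 ha])]
    · rw [indicator_of_notMem ha, max_eq_right (by linarith [hω.2 ha])]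
  have hnn : ∀ ω, 0 ≤ max (Z' ω - c) 0 - B.indicator (fun ω => Z' ω - c) ω := by
    intro ω
    by_cases ha : ω ∈ B
    · rw [indicator_of_mem ha]; linarith [le_max_left (Z' ω - c) 0]
    · rw [indicator_of_notMem ha]; linarith [le_max_right (Z' ω - c) 0]
  have hdiff : ∫ ω, (max (Z' ω - c) 0 - B.indicator (fun ω => Z' ω - c) ω) ∂μ
      = ∫ ω in A, Z ω ∂μ - ∫ ω in B, Z' ω ∂μ := by
    rw [integral_sub hp' iB, hpe, ← hZA, eA, eB, hr]; ring
  have hge : 0 ≤ ∫ ω, (max (Z' ω - c) 0 - B.indicator (fun ω => Z' ω - c) ω) ∂μ :=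
    integral_nonneg hnn
  refine ⟨by linarith, fun heq => ?_⟩
  have hz : ∫ ω, (max (Z' ω - c) 0 - B.indicator (fun ω => Z' ω - c) ω) ∂μ = 0 := by
    rw [hdiff, heq, sub_self]
  rw [integral_eq_zero_iff_of_nonneg hnn (hp'.sub iB)] at hz
  refine coSet_of_threshold μ Z' B c ?_
  filter_upwards [hz] with ω hω
  simp only [Pi.zero_apply] at hω
  constructor
  · intro hb
    rw [indicator_of_mem hb] at hω
    linarith [le_max_right (Z' ω - c) 0]
  · intro hb
    rw [indicator_of_notMem hb] at hω
    linarith [le_max_left (Z' ω - c) 0]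

lemma coSet_of_comon {Ω : Type*} [MeasurableSpace Ω] (μ : Measure Ω) [IsProbabilityMeasure μ]
    (Z X : Ω → ℝ) (h : Comonotone μ Z X) (t : ℝ) : CoSet μ Z {ω | t < X ω} := by
  filter_upwards [h] with q hq ha hb
  change t < X q.1 at ha
  change ¬ t < X q.2 at hb
  have : 0 < X q.1 - X q.2 := by linarith
  linarith [nonneg_of_mul_nonneg_left hq this]

lemma comon_of_coSet {Ω : Type*} [MeasurableSpace Ω] (μ : Measure Ω) [IsProbabilityMeasure μ]
    (Z X : Ω → ℝ) (T : Set ℝ) (hT : T.Countable)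
    (C : ℝ) (hX : ∀ᵐ ω ∂μ, |X ω| ≤ C)
    (hdense : ∀ a b, -C ≤ a → a < b → b ≤ C → ∃ t ∈ T, a < t ∧ t < b)
    (h : ∀ t ∈ T, CoSet μ Z {ω | t < X ω}) : Comonotone μ Z X := by
  have h1 := Measure.quasiMeasurePreserving_fst (μ := μ) (ν := μ) |>.ae hX
  have h2 := Measure.quasiMeasurePreserving_snd (μ := μ) (ν := μ) |>.ae hX
  have h3 : ∀ᵐ q ∂(μ.prod μ), ∀ t ∈ T, t < X q.1 → ¬ t < X q.2 → Z q.2 ≤ Z q.1 :=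
    (ae_ball_iff hT).2 h
  have h4 : ∀ᵐ q ∂(μ.prod μ), ∀ t ∈ T, t < X q.2 → ¬ t < X q.1 → Z q.1 ≤ Z q.2 :=
    (Measure.measurePreserving_swap (μ := μ) (ν := μ)).quasiMeasurePreserving.ae h3
  filter_upwards [h1, h2, h3, h4] with q h1 h2 h3 h4
  rw [abs_le] at h1 h2
  rcases lt_trichotomy (X q.1) (X q.2) with hlt | heq | hlt
  · obtain ⟨t, ht, hat, htb⟩ := hdense _ _ h1.1 hlt h2.2
    exact mul_nonneg_of_nonpos_of_nonpos (by linarith [h4 t ht htb hat.le.not_gt]) (by linarith)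
  · rw [heq]; simp
  · obtain ⟨t, ht, hat, htb⟩ := hdense _ _ h2.1 hlt h1.2
    exact mul_nonneg (by linarith [h3 t ht htb hat.le.not_gt]) (by linarith)

lemma layer {Ω : Type*} [MeasurableSpace Ω] (μ : Measure Ω) [IsProbabilityMeasure μ]
    (Z X : Ω → ℝ) (hi : Integrable Z μ) (hX : Measurable X)
    (C : ℝ) (hC : ∀ᵐ ω ∂μ, |X ω| ≤ C) :
    Integrable (fun t => ∫ ω in {ω | t < X ω}, Z ω ∂μ) (volume.restrict (Ioc (-C) C)) ∧
    ∫ ω, Z ω * X ω ∂μ = -C * ∫ ω, Z ω ∂μ +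
      ∫ t in Ioc (-C) C, ∫ ω in {ω | t < X ω}, Z ω ∂μ := by
  let D : Set (Ω × ℝ) := {q | q.2 < X q.1}
  have hD : MeasurableSet D := measurableSet_lt measurable_snd (hX.comp measurable_fst)
  let f : Ω → ℝ → ℝ := fun ω t => D.indicator (fun q => Z q.1) (ω, t)
  have hf : Integrable (Function.uncurry f) (μ.prod (volume.restrict (Ioc (-C) C))) :=
    (hi.comp_fst _).indicator hD
  have hft : ∀ t, ∫ ω, f ω t ∂μ = ∫ ω in {ω | t < X ω}, Z ω ∂μ := by
    intro t
    rw [← integral_indicator (measurableSet_lt measurable_const hX)]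
    rfl
  have hfω : ∀ ω, |X ω| ≤ C → ∫ t in Ioc (-C) C, f ω t = Z ω * (X ω + C) := by
    intro ω hω
    rw [abs_le] at hω
    have e1 : ∀ t, f ω t = (Iio (X ω)).indicator (fun _ => Z ω) t := fun t => rfl
    simp only [e1]
    rw [setIntegral_indicator measurableSet_Iio]
    have e2 : Ioc (-C) C ∩ Iio (X ω) = Ioo (-C) (X ω) := by
      ext t
      simp only [mem_inter_iff, mem_Ioc, mem_Iio, mem_Ioo]
      constructor
      · rintro ⟨⟨a, b⟩, c⟩; exact ⟨a, c⟩
      · rintro ⟨a, c⟩; exact ⟨⟨a, c.le.trans hω.2⟩, c⟩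
    rw [e2, setIntegral_const, Real.volume_real_Ioo_of_le hω.1, smul_eq_mul]
    ring
  refine ⟨?_, ?_⟩
  · have := hf.integral_prod_right
    simp only [Function.uncurry_apply_pair, hft] at this
    exact this
  · have hsw := integral_integral_swap hf
    simp only [hft] at hsw
    rw [← hsw]
    have e3 : ∫ ω, (∫ t in Ioc (-C) C, f ω t) ∂μ = ∫ ω, Z ω * (X ω + C) ∂μ :=
      integral_congr_ae (by filter_upwards [hC] with ω hω using hfω ω hω)
    rw [e3]
    have hZX : Integrable (fun ω => Z ω * X ω) μ :=
      hi.mul_bdd hX.aestronglyMeasurable (by simpa using hC)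
    simp only [mul_add]
    rw [integral_add hZX (hi.mul_const C), integral_mul_const]
    ring

lemma corr_main {Ω : Type*} [MeasurableSpace Ω] (μ : Measure Ω) [IsProbabilityMeasure μ]
    (Z Z' X X' : Ω → ℝ) (hZ : Measurable Z) (hZ' : Measurable Z') (hi : Integrable Z μ)
    (hmap : μ.map Z' = μ.map Z) (hX : Measurable X) (hX' : Measurable X')
    (hmapX : μ.map X' = μ.map X) (C : ℝ) (hC : ∀ᵐ ω ∂μ, |X ω| ≤ C)
    (h : Comonotone μ Z X) :
    ∫ ω, Z' ω * X' ω ∂μ ≤ ∫ ω, Z ω * X ω ∂μ ∧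
      (∫ ω, Z' ω * X' ω ∂μ = ∫ ω, Z ω * X ω ∂μ → Comonotone μ Z' X') := by
  have hi' : Integrable Z' μ := by
    have h1 : Integrable id (μ.map Z) :=
      (integrable_map_measure aestronglyMeasurable_id hZ.aemeasurable).2 hi
    rw [← hmap] at h1
    exact (integrable_map_measure aestronglyMeasurable_id hZ'.aemeasurable).1 h1
  have hEZ : ∫ ω, Z' ω ∂μ = ∫ ω, Z ω ∂μ := by
    have h1 : ∫ ω, id (Z' ω) ∂μ = ∫ ω, id (Z ω) ∂μ := by
      rw [← integral_map hZ'.aemeasurable aestronglyMeasurable_id,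
        ← integral_map hZ.aemeasurable aestronglyMeasurable_id, hmap]
    exact h1
  have hC' : ∀ᵐ ω ∂μ, |X' ω| ≤ C := by
    have hs : MeasurableSet {x : ℝ | |x| ≤ C} := measurableSet_le (by fun_prop) measurable_const
    have h1 : ∀ᵐ x ∂(μ.map X), |x| ≤ C := (ae_map_iff hX.aemeasurable hs).2 hC
    rw [← hmapX] at h1
    exact (ae_map_iff hX'.aemeasurable hs).1 h1
  obtain ⟨i1, e1⟩ := layer μ Z X hi hX C hC
  obtain ⟨i2, e2⟩ := layer μ Z' X' hi' hX' C hC'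
  have hmeas : ∀ t, μ {ω | t < X' ω} = μ {ω | t < X ω} := by
    intro t
    have h1 : μ.map X' (Ioi t) = μ.map X (Ioi t) := by rw [hmapX]
    rw [Measure.map_apply hX' measurableSet_Ioi, Measure.map_apply hX measurableSet_Ioi] at h1
    exact h1
  have key := fun t => coSet_main μ Z Z' hZ hZ' hi hi' hmap {ω | t < X ω} {ω | t < X' ω}
    (measurableSet_lt measurable_const hX) (measurableSet_lt measurable_const hX') (hmeas t)
    (coSet_of_comon μ Z X h t)
  have hle := integral_mono i2 i1 fun t => (key t).1
  rw [e1, e2, hEZ]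
  refine ⟨by simpa using hle, fun heq => ?_⟩
  have heq' := add_left_cancel heq
  have hae := (integral_eq_iff_of_ae_le i2 i1 (ae_of_all _ fun t => (key t).1)).1 heq'
  rw [Filter.EventuallyEq, ae_restrict_iff' measurableSet_Ioc] at hae
  obtain ⟨T, hTs, hTc, hTd⟩ := (Measure.dense_of_ae hae).exists_countable_dense_subset
  refine comon_of_coSet μ Z' X' (T ∩ Ioc (-C) C) (hTc.mono inter_subset_left) C hC' ?_ ?_
  · intro a b ha hab hb
    obtain ⟨t, ht, hat, htb⟩ := hTd.exists_between hab
    exact ⟨t, ⟨ht, by linarith, by linarith⟩, hat, htb⟩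
  · rintro t ⟨ht, htI⟩
    exact (key t).2 (hTs ht htI)

lemma maxCorr_eq {Ω : Type*} [MeasurableSpace Ω] (μ : Measure Ω) [IsProbabilityMeasure μ]
    (Z Z₀ X : Ω → ℝ) (hZ : Measurable Z) (hZ₀ : Measurable Z₀) (hi : Integrable Z μ)
    (hmap : μ.map Z₀ = μ.map Z) (hX : Measurable X) (C : ℝ) (hC : ∀ ω, |X ω| ≤ C)
    (h : Comonotone μ Z₀ X) :
    IsGreatest {r | ∃ Z' X' : Ω → ℝ, Measurable Z' ∧ Measurable X' ∧
      μ.map Z' = μ.map Z ∧ μ.map X' = μ.map X ∧ r = ∫ ω, Z' ω * X' ω ∂μ}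
      (∫ ω, Z₀ ω * X ω ∂μ) := by
  have hi₀ : Integrable Z₀ μ := by
    have h1 : Integrable id (μ.map Z) :=
      (integrable_map_measure aestronglyMeasurable_id hZ.aemeasurable).2 hi
    rw [← hmap] at h1
    exact (integrable_map_measure aestronglyMeasurable_id hZ₀.aemeasurable).1 h1
  refine ⟨⟨Z₀, X, hZ₀, hX, hmap, rfl, rfl⟩, ?_⟩
  rintro r ⟨Z', X', hZ', hX', hm, hmX, rfl⟩
  exact (corr_main μ Z₀ Z' X X' hZ₀ hZ' hi₀ (hm.trans hmap.symm) hX hX' hmX C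
    (ae_of_all _ hC) h).1

lemma comon_of_max {Ω : Type*} [MeasurableSpace Ω] (μ : Measure Ω) [IsProbabilityMeasure μ]
    (hna : Nonatomic μ)
    (Z Z' X : Ω → ℝ) (hZ : Measurable Z) (hZ' : Measurable Z') (hi : Integrable Z μ)
    (hmap : μ.map Z' = μ.map Z) (hX : Measurable X) (C : ℝ) (hC : ∀ ω, |X ω| ≤ C) :
    ∫ ω, Z' ω * X ω ∂μ ≤ maxCorr μ Z X ∧
      (∫ ω, Z' ω * X ω ∂μ = maxCorr μ Z X → Comonotone μ Z' X) := by
  obtain ⟨Z₀, hZ₀, hm₀, hc⟩ := exists_comon μ hna X Z hX hZ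
  have hi₀ : Integrable Z₀ μ := by
    have h1 : Integrable id (μ.map Z) :=
      (integrable_map_measure aestronglyMeasurable_id hZ.aemeasurable).2 hi
    rw [← hm₀] at h1
    exact (integrable_map_measure aestronglyMeasurable_id hZ₀.aemeasurable).1 h1
  have e : maxCorr μ Z X = ∫ ω, Z₀ ω * X ω ∂μ :=
    (maxCorr_eq μ Z Z₀ X hZ hZ₀ hi hm₀ hX C hC hc).csSup_eq
  rw [e]
  exact corr_main μ Z₀ Z' X X hZ₀ hZ' hi₀ (hmap.trans hm₀.symm) hX hX rfl C
    (ae_of_all _ hC) hc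

lemma ae_ne {Ω : Type*} [MeasurableSpace Ω] (μ : Measure Ω) [IsProbabilityMeasure μ]
    (Z : Ω → ℝ) (hZ : Measurable Z) (h0 : ∀ a : ℝ, μ.map Z {a} = 0) :
    ∀ᵐ q ∂(μ.prod μ), Z q.1 ≠ Z q.2 := by
  have hm : MeasurableSet {q : Ω × Ω | Z q.1 ≠ Z q.2} :=
    (measurableSet_eq_fun (hZ.comp measurable_fst) (hZ.comp measurable_snd)).compl
  rw [Measure.ae_prod_iff_ae_ae hm]
  refine ae_of_all _ fun ω => ?_
  have h1 := h0 (Z ω)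
  rw [Measure.map_apply hZ (measurableSet_singleton _), measure_eq_zero_iff_ae_notMem] at h1
  filter_upwards [h1] with ω' h2 h3
  exact h2 h3.symm

lemma one_to_two {Ω : Type*} [MeasurableSpace Ω] (μ : Measure Ω) [IsProbabilityMeasure μ]
    (hna : Nonatomic μ) {p : ℕ} (X : Fin p → Ω → ℝ)
    (hm : ∀ i, Measurable (X i)) (hb : ∀ i, ∃ C, ∀ ω, |X i ω| ≤ C)
    (h : ∀ i j, Comonotone μ (X i) (X j)) (Z : Ω → ℝ) (hZ : Measurable Z)
    (hi : Integrable Z μ) :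
    maxCorr μ Z (fun ω => ∑ i, X i ω) = ∑ i, maxCorr μ Z (X i) := by
  have hS : Measurable (fun ω => ∑ i, X i ω) := Finset.measurable_sum _ fun i _ => hm i
  choose C hC using hb
  have hCS : ∀ ω, |∑ i, X i ω| ≤ ∑ i, C i := fun ω =>
    (Finset.abs_sum_le_sum_abs _ _).trans (Finset.sum_le_sum fun i _ => hC i ω)
  obtain ⟨Z', hZ', hmap, hc⟩ := exists_comon μ hna _ Z hS hZ
  have hi' : Integrable Z' μ := by
    have h1 : Integrable id (μ.map Z) :=
      (integrable_map_measure aestronglyMeasurable_id hZ.aemeasurable).2 hi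
    rw [← hmap] at h1
    exact (integrable_map_measure aestronglyMeasurable_id hZ'.aemeasurable).1 h1
  have hci : ∀ i, Comonotone μ Z' (X i) := by
    intro i
    have hall : ∀ᵐ q ∂(μ.prod μ), ∀ j, 0 ≤ (X i q.1 - X i q.2) * (X j q.1 - X j q.2) :=
      ae_all_iff.2 fun j => h i j
    filter_upwards [hc, hall] with q hq ha
    have h1 : (X i q.1 - X i q.2) * (X i q.1 - X i q.2) ≤
        (X i q.1 - X i q.2) * (∑ j, X j q.1 - ∑ j, X j q.2) := by
      rw [← Finset.sum_sub_distrib, Finset.mul_sum]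
      exact Finset.single_le_sum (f := fun j => (X i q.1 - X i q.2) * (X j q.1 - X j q.2))
        (fun j _ => ha j) (Finset.mem_univ i)
    generalize X i q.1 - X i q.2 = x at *
    generalize ∑ j, X j q.1 - ∑ j, X j q.2 = s at *
    generalize Z' q.1 - Z' q.2 = z at *
    rcases lt_trichotomy x 0 with hx | hx | hx
    · have hs : s < 0 := by nlinarith
      exact mul_nonneg_of_nonpos_of_nonpos (by nlinarith) hx.le
    · rw [hx]; simp
    · have hs : 0 < s := by nlinarith
      exact mul_nonneg (by nlinarith) hx.le
  have e1 : maxCorr μ Z (fun ω => ∑ i, X i ω) = ∫ ω, Z' ω * ∑ i, X i ω ∂μ :=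
    (maxCorr_eq μ Z Z' _ hZ hZ' hi hmap hS _ hCS hc).csSup_eq
  have e2 : ∀ i, maxCorr μ Z (X i) = ∫ ω, Z' ω * X i ω ∂μ := fun i =>
    (maxCorr_eq μ Z Z' _ hZ hZ' hi hmap (hm i) _ (hC i) (hci i)).csSup_eq
  rw [e1]
  simp only [e2, Finset.mul_sum]
  exact integral_finsetSum _ fun i _ =>
    hi'.mul_bdd (hm i).aestronglyMeasurable (ae_of_all _ (by simpa using hC i))

lemma three_to_one {Ω : Type*} [MeasurableSpace Ω] (μ : Measure Ω) [IsProbabilityMeasure μ]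
    (hna : Nonatomic μ) {p : ℕ} (X : Fin p → Ω → ℝ)
    (hm : ∀ i, Measurable (X i)) (hb : ∀ i, ∃ C, ∀ ω, |X i ω| ≤ C)
    (Z : Ω → ℝ) (hZ : Measurable Z) (hi : Integrable Z μ) (h0 : ∀ a : ℝ, μ.map Z {a} = 0)
    (h : maxCorr μ Z (fun ω => ∑ i, X i ω) = ∑ i, maxCorr μ Z (X i)) :
    ∀ i j, Comonotone μ (X i) (X j) := by
  have hS : Measurable (fun ω => ∑ i, X i ω) := Finset.measurable_sum _ fun i _ => hm i
  choose C hC using hb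
  have hCS : ∀ ω, |∑ i, X i ω| ≤ ∑ i, C i := fun ω =>
    (Finset.abs_sum_le_sum_abs _ _).trans (Finset.sum_le_sum fun i _ => hC i ω)
  obtain ⟨Z', hZ', hmap, hc⟩ := exists_comon μ hna _ Z hS hZ
  have hi' : Integrable Z' μ := by
    have h1 : Integrable id (μ.map Z) :=
      (integrable_map_measure aestronglyMeasurable_id hZ.aemeasurable).2 hi
    rw [← hmap] at h1
    exact (integrable_map_measure aestronglyMeasurable_id hZ'.aemeasurable).1 h1
  have e1 : maxCorr μ Z (fun ω => ∑ i, X i ω) = ∫ ω, Z' ω * ∑ i, X i ω ∂μ :=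
    (maxCorr_eq μ Z Z' _ hZ hZ' hi hmap hS _ hCS hc).csSup_eq
  have e3 : ∫ ω, Z' ω * ∑ i, X i ω ∂μ = ∑ i, ∫ ω, Z' ω * X i ω ∂μ := by
    simp only [Finset.mul_sum]
    exact integral_finsetSum _ fun i _ =>
      hi'.mul_bdd (hm i).aestronglyMeasurable (ae_of_all _ (by simpa using hC i))
  have hmax := fun i => comon_of_max μ hna Z Z' (X i) hZ hZ' hi hmap (hm i) (C i) (hC i)
  have e4 : ∑ i, ∫ ω, Z' ω * X i ω ∂μ = ∑ i, maxCorr μ Z (X i) := by rw [← e3, ← e1, h]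
  have e5 := (Finset.sum_eq_sum_iff_of_le fun i _ => (hmax i).1).1 e4
  have hne := ae_ne μ Z' hZ' (by rw [hmap]; exact h0)
  intro i j
  filter_upwards [hne, (hmax i).2 (e5 i (Finset.mem_univ i)),
    (hmax j).2 (e5 j (Finset.mem_univ j))] with q hq hqi hqj
  rcases lt_or_gt_of_ne hq with hlt | hlt
  · exact mul_nonneg_of_nonpos_of_nonpos (by nlinarith) (by nlinarith)
  · exact mul_nonneg (by nlinarith) (by nlinarith)

/-- comonotonicity is equivalent to additivity of the maximal
correlation functional, for every (equivalently, some) non-atomic integrable Z. -/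
theorem stmt7 {Ω : Type*} [MeasurableSpace Ω] (μ : Measure Ω) [IsProbabilityMeasure μ]
    (hna : Nonatomic μ) {p : ℕ} (X : Fin p → Ω → ℝ)
    (hm : ∀ i, Measurable (X i)) (hb : ∀ i, ∃ C, ∀ ω, |X i ω| ≤ C) :
    ((∀ i j, Comonotone μ (X i) (X j)) ↔
      (∀ Z : Ω → ℝ, Measurable Z → Integrable Z μ → (∀ a : ℝ, μ.map Z {a} = 0) →
        maxCorr μ Z (fun ω => ∑ i, X i ω) = ∑ i, maxCorr μ Z (X i))) ∧
    ((∀ Z : Ω → ℝ, Measurable Z → Integrable Z μ → (∀ a : ℝ, μ.map Z {a} = 0) →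
        maxCorr μ Z (fun ω => ∑ i, X i ω) = ∑ i, maxCorr μ Z (X i)) ↔
      (∃ Z : Ω → ℝ, Measurable Z ∧ Integrable Z μ ∧ (∀ a : ℝ, μ.map Z {a} = 0) ∧
        maxCorr μ Z (fun ω => ∑ i, X i ω) = ∑ i, maxCorr μ Z (X i))) := by
  obtain ⟨V, hV, hV01, hV0⟩ := na_exists μ hna
  have hVi : Integrable V μ := by
    refine Integrable.of_bound hV.aestronglyMeasurable 1 (ae_of_all _ fun ω => ?_)
    rw [Real.norm_eq_abs, abs_le]
    exact ⟨by linarith [(hV01 ω).1], (hV01 ω).2⟩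
  have hVa : ∀ a : ℝ, μ.map V {a} = 0 := fun a => by
    rw [Measure.map_apply hV (measurableSet_singleton _), hV0]
  refine ⟨⟨fun h Z hZ hi _ => one_to_two μ hna X hm hb h Z hZ hi, fun h =>
    three_to_one μ hna X hm hb V hV hVi hVa (h V hV hVi hVa)⟩, ⟨fun h =>
    ⟨V, hV, hVi, hVa, h V hV hVi hVa⟩, ?_⟩⟩
  rintro ⟨Z, hZ, hi, h0, h⟩ Z' hZ' hi' _
  exact one_to_two μ hna X hm hb (three_to_one μ hna X hm hb Z hZ hi h0 h) Z' hZ' hi'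
end

section
/- On a non-atomic probability space, for every bounded real random variable X and every allocation (X₁,...,X_p) of X, there exists a comonotone allocation (Y₁,...,Y_p) of X with Yᵢ ⪰ Xᵢ in the concave order for every i; moreover if (X₁,...,X_p) is not comonotone, the dominating allocation can be chosen so that some Yᵢ strictly dominates Xᵢ. -/
open MeasureTheory

/-- Concave-order dominance for real random variables: Y ⪰ X. -/
def ConcaveDom {Ω : Type*} [MeasurableSpace Ω] (μ : Measure Ω) (Y X : Ω → ℝ) : Prop :=
  ∀ φ : ℝ → ℝ, ConvexOn ℝ Set.univ φ →
    ∫ ω, φ (Y ω) ∂μ ≤ ∫ ω, φ (X ω) ∂μ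

/-- An allocation of X among p agents. -/
def IsAlloc {Ω : Type*} [MeasurableSpace Ω] {p : ℕ}
    (X : Ω → ℝ) (Y : Fin p → Ω → ℝ) : Prop :=
  (∀ i, Measurable (Y i)) ∧ (∀ i, ∃ C, ∀ ω, |Y i ω| ≤ C) ∧
    ∀ ω, ∑ i, Y i ω = X ω

/-- comonotone dominance principle of Landsberger–Meilijson. -/
lemma aux_subgrad {φ : ℝ → ℝ} (hφ : ConvexOn ℝ Set.univ φ) (m : ℝ) :
    ∃ s : ℝ, ∀ x, φ m + s * (x - m) ≤ φ x := by
  refine ⟨derivWithin φ (Set.Ioi m) m, fun x => ?_⟩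
  rcases lt_trichotomy m x with h | h | h
  · have h1 := hφ.rightDeriv_le_slope_of_mem_interior (x := m) (y := x) (by simp) (by simp) h
    rw [slope_def_field, le_div_iff₀ (by linarith)] at h1
    linarith
  · subst h; simp
  · have h1 := hφ.slope_le_leftDeriv_of_mem_interior (x := x) (y := m) (by simp) (by simp) h
    have h2 := hφ.leftDeriv_le_rightDeriv_of_mem_interior (x := m) (by simp)
    have h3 := h1.trans h2
    rw [slope_def_field, div_le_iff₀ (by linarith)] at h3
    linarith

lemma aux_pointwise {φ : ℝ → ℝ} (hφ : ConvexOn ℝ Set.univ φ) {m s : ℝ}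
    (hs : ∀ x, φ m + s * (x - m) ≤ φ x) {u d : ℝ}
    (h1 : 0 < d → m ≤ u - d) (h2 : d < 0 → u - d ≤ m) :
    φ (u - d) ≤ φ u - s * d := by
  by_cases hd : d = 0
  · subst hd; simp
  have hne : u - m ≠ 0 := by
    rcases lt_or_gt_of_ne hd with h | h
    · have := h2 h; intro h'; linarith
    · have := h1 h; intro h'; linarith
  have ht0 : 0 ≤ d / (u - m) := by
    rcases lt_or_gt_of_ne hd with h | h
    · have := h2 h; exact div_nonneg_of_nonpos (by linarith) (by linarith)
    · have := h1 h; exact div_nonneg (by linarith) (by linarith)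
  have ht1 : d / (u - m) ≤ 1 := by
    rcases lt_or_gt_of_ne hd with h | h
    · have := h2 h
      exact (div_le_one_of_neg (by linarith)).2 (by linarith)
    · have := h1 h
      exact (div_le_one (by linarith)).2 (by linarith)
  set t := d / (u - m) with ht
  have htd : t * (u - m) = d := by rw [ht]; field_simp
  have hc := hφ.2 (Set.mem_univ m) (Set.mem_univ u) ht0 (by linarith : 0 ≤ 1 - t) (by ring)
  simp only [smul_eq_mul] at hc
  have he : t * m + (1 - t) * u = u - d := by rw [← htd]; ring
  rw [he] at hc
  have := mul_le_mul_of_nonneg_left (hs u) ht0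
  have h5 : s * d = t * (s * (u - m)) := by rw [← htd]; ring
  rw [h5]
  linarith

lemma aux_cont {φ : ℝ → ℝ} (hφ : ConvexOn ℝ Set.univ φ) : Continuous φ :=
  continuousOn_univ.1 (hφ.continuousOn isOpen_univ)

lemma aux_bdd {φ : ℝ → ℝ} (hφ : Continuous φ) (C : ℝ) :
    ∃ M, ∀ x, |x| ≤ C → ‖φ x‖ ≤ M := by
  obtain ⟨M, hM⟩ := (isCompact_Icc (a := -C) (b := C)).exists_bound_of_continuousOn hφ.continuousOn
  exact ⟨M, fun x hx => hM x (abs_le.1 hx)⟩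

lemma aux_int {Ω : Type*} [MeasurableSpace Ω] {μ : Measure Ω} [IsProbabilityMeasure μ]
    {φ : ℝ → ℝ} (hφ : Continuous φ) {U : Ω → ℝ} (hU : AEStronglyMeasurable U μ) {C : ℝ}
    (hC : ∀ᵐ ω ∂μ, |U ω| ≤ C) : Integrable (fun ω => φ (U ω)) μ := by
  obtain ⟨M, hM⟩ := aux_bdd hφ C
  exact Integrable.of_bound (hφ.comp_aestronglyMeasurable hU) M (hC.mono fun ω h => hM _ h)

lemma aux_transfer {Ω : Type*} [MeasurableSpace Ω] {μ : Measure Ω} [IsProbabilityMeasure μ]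
    {U D : Ω → ℝ} (hU : Measurable U) (hD : Measurable D) {C r m : ℝ}
    (hUC : ∀ ω, |U ω| ≤ C) (hDr : ∀ ω, |D ω| ≤ r) (hm : |m| ≤ C) (hD0 : ∫ ω, D ω ∂μ = 0)
    (h1 : ∀ ω, 0 < D ω → m ≤ U ω - D ω) (h2 : ∀ ω, D ω < 0 → U ω - D ω ≤ m) :
    (∀ ω, |U ω - D ω| ≤ C) ∧ ConcaveDom μ (fun ω => U ω - D ω) U ∧
      ∫ ω, (U ω - D ω) ^ 2 ∂μ ≤ ∫ ω, (U ω) ^ 2 ∂μ - ∫ ω, (D ω) ^ 2 ∂μ := by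
  have hb : ∀ ω, |U ω - D ω| ≤ C := by
    intro ω
    have := abs_le.1 (hUC ω)
    have := abs_le.1 hm
    have h1 := h1 ω
    have h2 := h2 ω
    rcases lt_trichotomy (D ω) 0 with h | h | h
    · have := h2 h
      rw [abs_le]; constructor <;> linarith
    · rw [h, sub_zero]; exact hUC ω
    · have := h1 h
      rw [abs_le]; constructor <;> linarith
  have hDi : Integrable D μ :=
    aux_int continuous_id hD.aestronglyMeasurable (Filter.Eventually.of_forall hDr)
  have hD2 : Integrable (fun ω => D ω ^ 2) μ :=
    aux_int (φ := fun x => x ^ 2) (by fun_prop) hD.aestronglyMeasurable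
      (Filter.Eventually.of_forall hDr)
  have hI : ∀ φ : ℝ → ℝ, Continuous φ → Integrable (fun ω => φ (U ω)) μ := fun φ h =>
    aux_int h hU.aestronglyMeasurable (Filter.Eventually.of_forall hUC)
  have hI' : ∀ φ : ℝ → ℝ, Continuous φ → Integrable (fun ω => φ (U ω - D ω)) μ := fun φ h =>
    aux_int h (hU.sub hD).aestronglyMeasurable (Filter.Eventually.of_forall hb)
  refine ⟨hb, fun φ hφ => ?_, ?_⟩
  · obtain ⟨s, hs⟩ := aux_subgrad hφ m
    calc ∫ ω, φ (U ω - D ω) ∂μ ≤ ∫ ω, (φ (U ω) - s * D ω) ∂μ :=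
          integral_mono (hI' φ (aux_cont hφ)) ((hI φ (aux_cont hφ)).sub (hDi.const_mul s))
            (fun ω => aux_pointwise hφ hs (h1 ω) (h2 ω))
      _ = ∫ ω, φ (U ω) ∂μ := by
          rw [integral_sub (hI φ (aux_cont hφ)) (hDi.const_mul s), integral_const_mul, hD0]
          simp
  · have hU2 := hI (fun x => x ^ 2) (by fun_prop)
    calc ∫ ω, (U ω - D ω) ^ 2 ∂μ ≤ ∫ ω, (U ω ^ 2 - D ω ^ 2 - 2 * m * D ω) ∂μ := by
          refine integral_mono (hI' (fun x => x ^ 2) (by fun_prop))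
            ((hU2.sub hD2).sub (hDi.const_mul (2 * m))) (fun ω => ?_)
          have : m * D ω ≤ (U ω - D ω) * D ω := by
            rcases lt_trichotomy (D ω) 0 with h | h | h
            · exact mul_le_mul_of_nonpos_right (h2 ω h) h.le
            · simp [h]
            · exact mul_le_mul_of_nonneg_right (h1 ω h) h.le
          simp only
          nlinarith
      _ = _ := by
          have := integral_sub (hU2.sub hD2) (hDi.const_mul (2 * m))
          simp only [Pi.sub_apply] at this
          rw [this, integral_sub hU2 hD2, integral_const_mul, hD0]
          simp

/-- If a pair is not comonotone there are two separated sets of positive measure. -/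
lemma aux_sets {Ω : Type*} [MeasurableSpace Ω] {μ : Measure Ω} [IsProbabilityMeasure μ]
    {U V : Ω → ℝ} (h : ¬ Comonotone μ U V) :
    ∃ a b r : ℝ, 0 < r ∧ μ {ω | a + r < U ω ∧ V ω < b - r} ≠ 0 ∧
      μ {ω | U ω < a - r ∧ b + r < V ω} ≠ 0 := by
  by_contra hcon
  push Not at hcon
  apply h
  have key : ∀ a b r : ℚ, ∀ᵐ q ∂(μ.prod μ), 0 < r →
      ¬ ((a + r < U q.1 ∧ V q.1 < b - r) ∧ (U q.2 < a - r ∧ b + r < V q.2)) ∧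
      ¬ ((U q.1 < a - r ∧ b + r < V q.1) ∧ (a + r < U q.2 ∧ V q.2 < b - r)) := by
    intro a b r
    by_cases hr : 0 < r
    swap
    · exact Filter.Eventually.of_forall fun q h => absurd h hr
    set A := {ω | (a : ℝ) + r < U ω ∧ V ω < b - r} with hA
    set B := {ω | U ω < a - r ∧ (b : ℝ) + r < V ω} with hB
    have h0 : μ A = 0 ∨ μ B = 0 := by
      by_cases hA0 : μ A = 0
      · exact Or.inl hA0
      · exact Or.inr (hcon a b r (by exact_mod_cast hr) hA0)
    have e1 : (μ.prod μ) (A ×ˢ B) = 0 := by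
      rw [Measure.prod_prod]; rcases h0 with h | h <;> simp [h]
    have e2 : (μ.prod μ) (B ×ˢ A) = 0 := by
      rw [Measure.prod_prod]; rcases h0 with h | h <;> simp [h]
    filter_upwards [measure_eq_zero_iff_ae_notMem.1 e1, measure_eq_zero_iff_ae_notMem.1 e2]
      with q h1 h2 _
    exact ⟨h1, h2⟩
  have key' := ae_all_iff.2 fun a => ae_all_iff.2 fun b => ae_all_iff.2 fun r => key a b r
  have sep : ∀ x y x' y' : ℝ, x' < x → y < y' → ∃ a b r : ℚ, 0 < r ∧
      ((a + r < x ∧ y < b - r) ∧ (x' < a - r ∧ b + r < y')) := by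
    intro x y x' y' hx hy
    obtain ⟨a, ha1, ha2⟩ := exists_rat_btwn hx
    obtain ⟨b, hb1, hb2⟩ := exists_rat_btwn hy
    obtain ⟨r, hr0, hr⟩ := exists_rat_btwn (show (0:ℝ) < min (min (a - x') (x - a))
      (min (b - y) (y' - b)) by simp [ha1, ha2, hb1, hb2])
    simp only [lt_min_iff] at hr
    exact ⟨a, b, r, by exact_mod_cast hr0, by constructor <;> constructor <;> linarith⟩
  unfold Comonotone
  filter_upwards [key'] with q hq
  by_contra hneg
  push Not at hneg
  rcases mul_neg_iff.1 hneg with ⟨h1, h2⟩ | ⟨h1, h2⟩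
  · obtain ⟨a, b, r, hr, h3⟩ := sep (U q.1) (V q.1) (U q.2) (V q.2) (by linarith) (by linarith)
    exact (hq a b r hr).1 h3
  · obtain ⟨a, b, r, hr, h3⟩ := sep (U q.2) (V q.2) (U q.1) (V q.1) (by linarith) (by linarith)
    exact (hq a b r hr).2 ⟨h3.2, h3.1⟩

/-- Admissible competitor allocations. -/
def AuxAdm {Ω : Type*} [MeasurableSpace Ω] (μ : Measure Ω) {p : ℕ} (C : ℝ)
    (X : Ω → ℝ) (Xi : Fin p → Ω → ℝ) (Y : Fin p → Ω → ℝ) : Prop :=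
  (∀ i, Measurable (Y i)) ∧ (∀ i ω, |Y i ω| ≤ C) ∧ (∀ ω, ∑ i, Y i ω = X ω) ∧
    ∀ i, ConcaveDom μ (Y i) (Xi i)

lemma aux_improve {Ω : Type*} [MeasurableSpace Ω] {μ : Measure Ω} [IsProbabilityMeasure μ]
    {p : ℕ} {C : ℝ} {X : Ω → ℝ} {Xi Y : Fin p → Ω → ℝ} (hY : AuxAdm μ C X Xi Y)
    (h : ¬ ∀ i j, Comonotone μ (Y i) (Y j)) :
    ∃ Z, AuxAdm μ C X Xi Z ∧ ∑ i, ∫ ω, Z i ω ^ 2 ∂μ < ∑ i, ∫ ω, Y i ω ^ 2 ∂μ := by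
  push Not at h
  obtain ⟨i, j, hij⟩ := h
  obtain ⟨hYm, hYC, hYs, hYd⟩ := hY
  have hne : i ≠ j := by
    rintro rfl
    exact hij (Filter.Eventually.of_forall fun q => mul_self_nonneg _)
  obtain ⟨a, b, r, hr, hA0, hB0⟩ := aux_sets hij
  set A := {ω | a + r < Y i ω ∧ Y j ω < b - r} with hA
  set B := {ω | Y i ω < a - r ∧ b + r < Y j ω} with hB
  have hAm : MeasurableSet A :=
    (measurableSet_lt measurable_const (hYm i)).inter (measurableSet_lt (hYm j) measurable_const)
  have hBm : MeasurableSet B :=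
    (measurableSet_lt (hYm i) measurable_const).inter (measurableSet_lt measurable_const (hYm j))
  have hAB : ∀ ω, ω ∈ A → ω ∉ B := by
    intro ω h1 h2
    have := h1.1; have := h2.1; linarith
  have hAp : 0 < μ.real A := ENNReal.toReal_pos hA0 (measure_ne_top _ _)
  have hBp : 0 < μ.real B := ENNReal.toReal_pos hB0 (measure_ne_top _ _)
  have hA1 : μ.real A ≤ 1 := measureReal_le_one
  have hB1 : μ.real B ≤ 1 := measureReal_le_one
  obtain ⟨x, hx⟩ := nonempty_of_measure_ne_zero hA0
  obtain ⟨y, hy⟩ := nonempty_of_measure_ne_zero hB0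
  set D : Ω → ℝ := fun ω => A.indicator (fun _ => r * μ.real B) ω
    - B.indicator (fun _ => r * μ.real A) ω with hDdef
  have hDA : ∀ ω ∈ A, D ω = r * μ.real B := fun ω h => by
    simp [hDdef, h, hAB ω h]
  have hDB : ∀ ω ∈ B, D ω = - (r * μ.real A) := fun ω h => by
    have : ω ∉ A := fun h' => hAB ω h' h
    simp [hDdef, h, this]
  have hDO : ∀ ω, ω ∉ A → ω ∉ B → D ω = 0 := fun ω h h' => by simp [hDdef, h, h']
  have hrA : 0 < r * μ.real A := by positivity
  have hrB : 0 < r * μ.real B := by positivity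
  have hrA1 : r * μ.real A ≤ r := by nlinarith
  have hrB1 : r * μ.real B ≤ r := by nlinarith
  have hDm : Measurable D :=
    (measurable_const.indicator hAm).sub (measurable_const.indicator hBm)
  have hDr : ∀ ω, |D ω| ≤ r := by
    intro ω
    by_cases h1 : ω ∈ A
    · rw [hDA ω h1, abs_le]; constructor <;> linarith
    by_cases h2 : ω ∈ B
    · rw [hDB ω h2, abs_le]; constructor <;> linarith
    rw [hDO ω h1 h2]; simpa using hr.le
  have hpos : ∀ ω, 0 < D ω → ω ∈ A := by
    intro ω h
    by_contra h1
    by_cases h2 : ω ∈ B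
    · rw [hDB ω h2] at h; linarith
    · rw [hDO ω h1 h2] at h; linarith
  have hneg : ∀ ω, D ω < 0 → ω ∈ B := by
    intro ω h
    by_contra h1
    by_cases h2 : ω ∈ A
    · rw [hDA ω h2] at h; linarith
    · rw [hDO ω h2 h1] at h; linarith
  have hD0 : ∫ ω, D ω ∂μ = 0 := by
    rw [hDdef, integral_sub ((integrable_const _).indicator hAm) ((integrable_const _).indicator hBm),
      integral_indicator_const _ hAm, integral_indicator_const _ hBm]
    simp only [smul_eq_mul]; ring
  have hD2 : 0 < ∫ ω, D ω ^ 2 ∂μ := by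
    have hi : Integrable (fun ω => D ω ^ 2) μ :=
      aux_int (φ := fun x => x ^ 2) (by fun_prop) hDm.aestronglyMeasurable
        (Filter.Eventually.of_forall hDr)
    rw [integral_pos_iff_support_of_nonneg (fun ω => sq_nonneg _) hi]
    refine lt_of_lt_of_le (pos_iff_ne_zero.2 hA0) (measure_mono fun ω h => ?_)
    rw [Function.mem_support, hDA ω h]
    positivity
  have Ti := aux_transfer (μ := μ) (m := a) (hYm i) hDm (hYC i) hDr (by
      have := hx.1; have := hy.1
      have := abs_le.1 (hYC i x); have := abs_le.1 (hYC i y)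
      rw [abs_le]; constructor <;> linarith) hD0
    (fun ω h => by
      have := (hpos ω h).1
      have := abs_le.1 (hDr ω); linarith)
    (fun ω h => by
      have := (hneg ω h).1
      have := abs_le.1 (hDr ω); linarith)
  have Tj := aux_transfer (μ := μ) (m := b) (D := fun ω => - D ω) (r := r) (hYm j) hDm.neg (hYC j)
    (fun ω => by rw [abs_neg]; exact hDr ω) (by
      have := hx.2; have := hy.2
      have := abs_le.1 (hYC j x); have := abs_le.1 (hYC j y)
      rw [abs_le]; constructor <;> linarith) (by rw [integral_neg, hD0, neg_zero])
    (fun ω h => by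
      have := (hneg ω (by linarith)).2
      have := abs_le.1 (hDr ω); linarith)
    (fun ω h => by
      have := (hpos ω (by linarith)).2
      have := abs_le.1 (hDr ω); linarith)
  obtain ⟨Ti1, Ti2, Ti3⟩ := Ti
  obtain ⟨Tj1, Tj2, Tj3⟩ := Tj
  have hnij : j ≠ i := hne.symm
  let Z : Fin p → Ω → ℝ := fun k =>
    if k = i then fun ω => Y i ω - D ω else if k = j then fun ω => Y j ω - - D ω else Y k
  have Zi : Z i = fun ω => Y i ω - D ω := by simp [Z]
  have Zj : Z j = fun ω => Y j ω - - D ω := by simp [Z, hnij]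
  have Zk : ∀ k, k ≠ i → k ≠ j → Z k = Y k := fun k h h' => by simp [Z, h, h']
  have split : ∀ f g : Fin p → ℝ, (∀ k, k ≠ i → k ≠ j → f k = g k) →
      ∑ k, f k - ∑ k, g k = (f i - g i) + (f j - g j) := by
    intro f g hfg
    rw [← Finset.sum_sub_distrib]
    refine Finset.sum_eq_add i j hne ?_ (by simp) (by simp)
    intro k _ hk
    rw [hfg k hk.1 hk.2, sub_self]
  refine ⟨Z, ⟨fun k => ?_, fun k ω => ?_, fun ω => ?_, fun k => ?_⟩, ?_⟩
  · by_cases h1 : k = i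
    · rw [h1, Zi]; exact (hYm i).sub hDm
    by_cases h2 : k = j
    · rw [h2, Zj]; exact (hYm j).sub hDm.neg
    rw [Zk k h1 h2]; exact hYm k
  · by_cases h1 : k = i
    · rw [h1, Zi]; exact Ti1 ω
    by_cases h2 : k = j
    · rw [h2, Zj]; exact Tj1 ω
    rw [Zk k h1 h2]; exact hYC k ω
  · have := split (fun k => Z k ω) (fun k => Y k ω) (fun k h h' => by simp only [Zk k h h'])
    simp only [Zi, Zj, hYs ω] at this
    linarith
  · by_cases h1 : k = i
    · rw [h1, Zi]; exact fun φ hφ => (Ti2 φ hφ).trans (hYd i φ hφ)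
    by_cases h2 : k = j
    · rw [h2, Zj]; exact fun φ hφ => (Tj2 φ hφ).trans (hYd j φ hφ)
    rw [Zk k h1 h2]; exact hYd k
  · have := split (fun k => ∫ ω, Z k ω ^ 2 ∂μ) (fun k => ∫ ω, Y k ω ^ 2 ∂μ)
      (fun k h h' => by simp only [Zk k h h'])
    simp only [Zi, Zj] at this
    simp only [neg_sq] at Tj3
    linarith

lemma aux_ext {Ω : Type*} [MeasurableSpace Ω] {μ : Measure Ω} {Y Z W : Ω → ℝ}
    (h : Y =ᵐ[μ] Z) (hd : ConcaveDom μ Y W) : ConcaveDom μ Z W := by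
  intro φ hφ
  rw [← integral_congr_ae (h.mono fun ω h => by simp only [h] : (fun ω => φ (Y ω)) =ᵐ[μ] fun ω => φ (Z ω))]
  exact hd φ hφ

/-- Almost everywhere version of admissibility. -/
def AuxAE {Ω : Type*} [MeasurableSpace Ω] (μ : Measure Ω) {p : ℕ} (C : ℝ)
    (X : Ω → ℝ) (Xi : Fin p → Ω → ℝ) (f : Ω → EuclideanSpace ℝ (Fin p)) : Prop :=
  (∀ᵐ ω ∂μ, (∀ i, |f ω i| ≤ C) ∧ ∑ i, f ω i = X ω) ∧
    ∀ i, ConcaveDom μ (fun ω => f ω i) (Xi i)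

lemma aux_min {Ω : Type*} [MeasurableSpace Ω] {μ : Measure Ω} [IsProbabilityMeasure μ]
    {p : ℕ} {C : ℝ} {X : Ω → ℝ} {Xi : Fin p → Ω → ℝ} (hX : AuxAdm μ C X Xi Xi) :
    ∃ Y, AuxAdm μ C X Xi Y ∧
      ∀ Z, AuxAdm μ C X Xi Z → ∑ i, ∫ ω, Y i ω ^ 2 ∂μ ≤ ∑ i, ∫ ω, Z i ω ^ 2 ∂μ := by
  let K : Set (Lp (EuclideanSpace ℝ (Fin p)) 2 μ) := {f | AuxAE μ C X Xi f}
  have hcoord : ∀ (f : Lp (EuclideanSpace ℝ (Fin p)) 2 μ) i, AEStronglyMeasurable (fun ω => f ω i) μ := fun f i =>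
    (by fun_prop : Continuous fun x : EuclideanSpace ℝ (Fin p) => x i).comp_aestronglyMeasurable (Lp.aestronglyMeasurable f)
  -- admissible allocations give elements of K
  have hmk : ∀ Z, AuxAdm μ C X Xi Z → ∃ f ∈ K, ∀ᵐ ω ∂μ, ∀ i, f ω i = Z i ω := by
    rintro Z ⟨hm, hC, hs, hd⟩
    have hmeas : Measurable (fun ω => (WithLp.toLp 2 (fun i => Z i ω) : EuclideanSpace ℝ (Fin p))) := by
      have : Measurable (fun ω => (fun i => Z i ω)) := measurable_pi_lambda _ hm
      exact (WithLp.measurable_toLp 2 _).comp this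
    have hcomp : IsCompact ((fun v : Fin p → ℝ => (WithLp.toLp 2 v : EuclideanSpace ℝ (Fin p))) ''
        (Set.univ.pi fun _ => Set.Icc (-C) C)) :=
      (isCompact_univ_pi fun _ => isCompact_Icc).image (PiLp.continuous_toLp 2 _)
    obtain ⟨M, hM⟩ := hcomp.isBounded.exists_norm_le
    have hLp : MemLp (fun ω => (WithLp.toLp 2 (fun i => Z i ω) : EuclideanSpace ℝ (Fin p))) 2 μ := by
      refine MemLp.of_bound hmeas.aestronglyMeasurable M (Filter.Eventually.of_forall fun ω => ?_)
      exact hM _ ⟨fun i => Z i ω, fun i _ => abs_le.1 (hC i ω), rfl⟩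
    have hae : ∀ᵐ ω ∂μ, ∀ i, (hLp.toLp _) ω i = Z i ω := by
      filter_upwards [hLp.coeFn_toLp] with ω h i
      rw [h]
    refine ⟨hLp.toLp _, ⟨?_, fun i => ?_⟩, hae⟩
    · filter_upwards [hae] with ω h
      simp only [h]
      exact ⟨fun i => hC i ω, hs ω⟩
    · exact aux_ext (hae.mono fun ω h => (h i).symm) (hd i)
  have hnorm : ∀ (f : Lp (EuclideanSpace ℝ (Fin p)) 2 μ) (Z : Fin p → Ω → ℝ), (∀ i ω, |Z i ω| ≤ C) → (∀ i, Measurable (Z i)) →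
      (∀ᵐ ω ∂μ, ∀ i, f ω i = Z i ω) → ‖f‖ ^ 2 = ∑ i, ∫ ω, Z i ω ^ 2 ∂μ := by
    intro f Z hC hm hae
    rw [← integral_finsetSum _ (fun i _ => aux_int (φ := fun x => x ^ 2) (by fun_prop)
      (hm i).aestronglyMeasurable (Filter.Eventually.of_forall (hC i))),
      ← real_inner_self_eq_norm_sq, L2.inner_def]
    refine integral_congr_ae ?_
    filter_upwards [hae] with ω h
    rw [real_inner_self_eq_norm_sq, EuclideanSpace.real_norm_sq_eq]
    simp only [h]
  have hne : K.Nonempty := by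
    obtain ⟨f, hf, -⟩ := hmk Xi hX
    exact ⟨f, hf⟩
  have hconv : Convex ℝ K := by
    intro f hf g hg s t hs ht hst
    have hae : ∀ᵐ ω ∂μ, ∀ i, (s • f + t • g : Lp (EuclideanSpace ℝ (Fin p)) 2 μ) ω i = s * f ω i + t * g ω i := by
      filter_upwards [Lp.coeFn_add (s • f) (t • g), Lp.coeFn_smul s f, Lp.coeFn_smul t g]
        with ω h1 h2 h3 i
      rw [h1, Pi.add_apply, h2, h3]; simp
    refine ⟨?_, fun i φ hφ => ?_⟩
    · filter_upwards [hae, hf.1, hg.1] with ω h h1 h2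
      simp only [h]
      refine ⟨fun i => ?_, ?_⟩
      · have e1 := abs_le.1 (h1.1 i)
        have e2 := abs_le.1 (h2.1 i)
        have : t = 1 - s := by linarith
        subst this
        rw [abs_le]; constructor <;> nlinarith
      · rw [Finset.sum_add_distrib, ← Finset.mul_sum, ← Finset.mul_sum, h1.2, h2.2, ← add_mul, hst,
          one_mul]
    · have i1 := aux_int (aux_cont hφ) (hcoord f i) (hf.1.mono fun ω h => h.1 i)
      have i2 := aux_int (aux_cont hφ) (hcoord g i) (hg.1.mono fun ω h => h.1 i)
      have i3 : Integrable (fun ω => φ (s * f ω i + t * g ω i)) μ := by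
        refine aux_int (C := s * C + t * C) (aux_cont hφ)
          (((hcoord f i).const_mul s).add ((hcoord g i).const_mul t)) ?_
        filter_upwards [hf.1, hg.1] with ω h1 h2
        refine (abs_add_le _ _).trans ?_
        rw [abs_mul, abs_mul, abs_of_nonneg hs, abs_of_nonneg ht]
        exact add_le_add (mul_le_mul_of_nonneg_left (h1.1 i) hs)
          (mul_le_mul_of_nonneg_left (h2.1 i) ht)
      calc ∫ ω, φ ((s • f + t • g : Lp (EuclideanSpace ℝ (Fin p)) 2 μ) ω i) ∂μ = ∫ ω, φ (s * f ω i + t * g ω i) ∂μ :=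
            integral_congr_ae (hae.mono fun ω h => by simp only [h])
        _ ≤ ∫ ω, (s * φ (f ω i) + t * φ (g ω i)) ∂μ :=
            integral_mono i3 ((i1.const_mul s).add (i2.const_mul t))
              (fun ω => hφ.2 (Set.mem_univ _) (Set.mem_univ _) hs ht hst)
        _ = s * ∫ ω, φ (f ω i) ∂μ + t * ∫ ω, φ (g ω i) ∂μ := by
            rw [integral_add (i1.const_mul s) (i2.const_mul t), integral_const_mul,
              integral_const_mul]
        _ ≤ s * ∫ ω, φ (Xi i ω) ∂μ + t * ∫ ω, φ (Xi i ω) ∂μ :=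
            add_le_add (mul_le_mul_of_nonneg_left (hf.2 i φ hφ) hs)
              (mul_le_mul_of_nonneg_left (hg.2 i φ hφ) ht)
        _ = _ := by rw [← add_mul, hst, one_mul]
  have hclosed : IsClosed K := by
    refine IsSeqClosed.isClosed ?_
    intro u f hu hlim
    obtain ⟨ns, -, hns⟩ := (tendstoInMeasure_of_tendsto_Lp hlim).exists_seq_tendsto_ae
    have hall : ∀ᵐ ω ∂μ, ∀ n, (∀ i, |u n ω i| ≤ C) ∧ ∑ i, u n ω i = X ω :=
      ae_all_iff.2 fun n => (hu n).1
    have hci : ∀ᵐ ω ∂μ, ∀ i, Filter.Tendsto (fun n => u (ns n) ω i) Filter.atTop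
        (nhds (f ω i)) := by
      filter_upwards [hns] with ω h i
      exact ((by fun_prop : Continuous fun x : EuclideanSpace ℝ (Fin p) => x i).tendsto _).comp h
    refine ⟨?_, fun i φ hφ => ?_⟩
    · filter_upwards [hall, hci] with ω h1 h2
      refine ⟨fun i => le_of_tendsto (h2 i).abs (Filter.Eventually.of_forall fun n => (h1 _).1 i), ?_⟩
      refine tendsto_nhds_unique (tendsto_finsetSum _ fun i _ => h2 i) ?_
      simp only [(h1 _).2]
      exact tendsto_const_nhds
    · obtain ⟨M, hM⟩ := aux_bdd (aux_cont hφ) C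
      refine le_of_tendsto (tendsto_integral_of_dominated_convergence (fun _ => M)
        (F := fun n ω => φ (u (ns n) ω i)) (fun n =>
          (aux_cont hφ).comp_aestronglyMeasurable (hcoord _ i)) (integrable_const _) (fun n => ?_) ?_)
        (Filter.Eventually.of_forall fun n => (hu (ns n)).2 i φ hφ)
      · filter_upwards [hall] with ω h
        exact hM _ ((h _).1 i)
      · filter_upwards [hci] with ω h
        exact ((aux_cont hφ).tendsto _).comp (h i)
  obtain ⟨f, hfK, hf⟩ := exists_norm_eq_iInf_of_complete_convex hne hclosed.isComplete hconv 0
  have hmin : ∀ g ∈ K, ‖f‖ ≤ ‖g‖ := by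
    intro g hg
    have : ‖(0 : Lp (EuclideanSpace ℝ (Fin p)) 2 μ) - f‖ ≤ ‖(0 : Lp (EuclideanSpace ℝ (Fin p)) 2 μ) - g‖ := by
      rw [hf]
      exact ciInf_le (f := fun w : K => ‖(0 : Lp (EuclideanSpace ℝ (Fin p)) 2 μ) - w‖)
        ⟨0, Set.forall_mem_range.2 fun _ => norm_nonneg _⟩ ⟨g, hg⟩
    simpa using this
  -- choose a representative
  obtain ⟨G, hGsub, hGm, hG0⟩ : ∃ G : Set Ω, (∀ ω ∈ G, (∀ i, |f ω i| ≤ C) ∧ ∑ i, f ω i = X ω) ∧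
      MeasurableSet G ∧ ∀ᵐ ω ∂μ, ω ∈ G := by
    have h0 := hfK.1
    rw [ae_iff] at h0
    refine ⟨(toMeasurable μ _)ᶜ, fun ω h => ?_, (measurableSet_toMeasurable μ _).compl,
      measure_eq_zero_iff_ae_notMem.1 ((measure_toMeasurable _).trans h0)⟩
    by_contra hc
    exact h (subset_toMeasurable μ _ hc)
  classical
  let Y : Fin p → Ω → ℝ := fun i => G.piecewise (fun ω => f ω i) (Xi i)
  have hYf : ∀ᵐ ω ∂μ, ∀ i, f ω i = Y i ω := by
    filter_upwards [hG0] with ω h i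
    simp [Y, h]
  have hYm : ∀ i, Measurable (Y i) := fun i =>
    Measurable.piecewise hGm ((by fun_prop : Continuous fun x : EuclideanSpace ℝ (Fin p) => x i).measurable.comp
      (Lp.stronglyMeasurable f).measurable) (hX.1 i)
  have hYC : ∀ i ω, |Y i ω| ≤ C := by
    intro i ω
    by_cases h : ω ∈ G
    · simpa [Y, h] using (hGsub ω h).1 i
    · simpa [Y, h] using hX.2.1 i ω
  refine ⟨Y, ⟨hYm, hYC, fun ω => ?_, fun i => aux_ext (hYf.mono fun ω h => h i) (hfK.2 i)⟩, ?_⟩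
  · by_cases h : ω ∈ G
    · simpa [Y, h] using (hGsub ω h).2
    · simpa [Y, h] using hX.2.2.1 ω
  · intro Z hZ
    obtain ⟨g, hgK, hg⟩ := hmk Z hZ
    rw [← hnorm f Y hYC hYm hYf, ← hnorm g Z hZ.2.1 hZ.1 hg]
    exact pow_le_pow_left₀ (norm_nonneg _) (hmin g hgK) 2

/-- comonotone dominance principle of Landsberger–Meilijson. -/
theorem stmt12 {Ω : Type*} [MeasurableSpace Ω] (μ : Measure Ω) [IsProbabilityMeasure μ]
    (hna : Nonatomic μ) {p : ℕ}
    (X : Ω → ℝ) (hXm : Measurable X) (hXb : ∃ C, ∀ ω, |X ω| ≤ C)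
    (Xi : Fin p → Ω → ℝ) (hXi : IsAlloc X Xi) :
    ∃ Y : Fin p → Ω → ℝ, IsAlloc X Y ∧
      (∀ i j, Comonotone μ (Y i) (Y j)) ∧
      (∀ i, ConcaveDom μ (Y i) (Xi i)) ∧
      (¬ (∀ i j, Comonotone μ (Xi i) (Xi j)) →
        ∃ i, ∃ φ : ℝ → ℝ, ConvexOn ℝ Set.univ φ ∧
          ∫ ω, φ (Y i ω) ∂μ < ∫ ω, φ (Xi i ω) ∂μ) := by
  obtain ⟨hm, hb, hs⟩ := hXi
  choose c hc using hb
  have hA : AuxAdm μ (∑ i, |c i|) X Xi Xi := by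
    refine ⟨hm, fun i ω => ?_, hs, fun i φ _ => le_refl _⟩
    exact ((hc i ω).trans (le_abs_self _)).trans
      (Finset.single_le_sum (f := fun i => |c i|) (fun _ _ => abs_nonneg _) (Finset.mem_univ i))
  obtain ⟨Y, hY, hmin⟩ := aux_min hA
  refine ⟨Y, ⟨hY.1, fun i => ⟨_, hY.2.1 i⟩, hY.2.2.1⟩, ?_, hY.2.2.2, fun hnc => ?_⟩
  · by_contra hcon
    obtain ⟨Z, hZ, hlt⟩ := aux_improve hY hcon
    exact absurd (hmin Z hZ) (not_le.2 hlt)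
  · obtain ⟨Z, hZ, hlt⟩ := aux_improve hA hnc
    obtain ⟨i, -, hi⟩ := Finset.exists_lt_of_sum_lt ((hmin Z hZ).trans_lt hlt)
    exact ⟨i, fun x => x ^ 2, even_two.convexOn_pow, hi⟩
end

section
/- On a non-atomic probability space, the set of Pareto efficient allocations (for the concave order) of a bounded real random variable X is convex, and can be written as {(λ₁,...,λ_p) : Σᵢ λᵢ = 0} + A₀ with A₀ compact in (L^∞)^p; in particular it is closed in (L^∞)^p. -/
open MeasureTheory
open scoped Pointwise

/-- Pareto efficiency for the concave order. -/
def EfficientAlloc {Ω : Type*} [MeasurableSpace Ω] (μ : Measure Ω) {p : ℕ}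
    (X : Ω → ℝ) (Xi : Fin p → Ω → ℝ) : Prop :=
  ¬ ∃ Y : Fin p → Ω → ℝ, IsAlloc X Y ∧
      (∀ i, ConcaveDom μ (Y i) (Xi i)) ∧
      ∃ i, ∃ φ : ℝ → ℝ, ConvexOn ℝ Set.univ φ ∧
        ∫ ω, φ (Y i ω) ∂μ < ∫ ω, φ (Xi i ω) ∂μ

lemma ext_chain {ι : Type*} [Nonempty ι] {p : ℕ} (hp : 0 < p) (Z : Fin p → ι → ℝ) (C : ℝ)
    (hb : ∀ i, BddBelow (Set.range (Z i)))
    (hX : ∀ w, |∑ i, Z i w| ≤ C)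
    (hc : ∀ w w', (∀ i, Z i w ≤ Z i w') ∨ (∀ i, Z i w' ≤ Z i w)) :
    ∃ f : Fin p → ℝ → ℝ, (∀ i, Monotone (f i)) ∧ (∀ x, ∑ i, f i x = x) ∧
      ∀ w i, f i (∑ j, Z j w) = Z i w := by
  classical
  set X : ι → ℝ := fun w => ∑ i, Z i w with hXdef
  let g : Fin p → ℝ → ℝ := fun i x => ⨅ w, (Z i w + max (x - X w) 0)
  have hbd : ∀ i x, BddBelow (Set.range fun w => Z i w + max (x - X w) 0) := by
    intro i x
    obtain ⟨m, hm⟩ := hb i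
    refine ⟨m, ?_⟩
    rintro _ ⟨w, rfl⟩
    have := hm ⟨w, rfl⟩
    have h2 : 0 ≤ max (x - X w) 0 := le_max_right _ _
    simp only; linarith
  have gmono : ∀ i, Monotone (g i) := by
    intro i x y hxy
    refine ciInf_mono (hbd i x) fun w => ?_
    gcongr
  have glip : ∀ i x y, x ≤ y → g i y ≤ g i x + (y - x) := by
    intro i x y hxy
    have : g i y - (y - x) ≤ g i x := by
      refine le_ciInf fun w => ?_
      have h1 : g i y ≤ Z i w + max (y - X w) 0 := ciInf_le (hbd i y) w
      have h2 : max (y - X w) 0 ≤ max (x - X w) 0 + (y - x) := by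
        apply max_le
        · linarith [le_max_left (x - X w) 0]
        · linarith [le_max_right (x - X w) 0]
      linarith
    linarith
  have gcont : ∀ i, Continuous (g i) := by
    intro i
    have : LipschitzWith 1 (g i) := by
      apply LipschitzWith.of_le_add
      intro x y
      rcases le_total x y with h | h
      · exact (gmono i h).trans (by linarith [dist_nonneg (x := x) (y := y)])
      · have := glip i y x h
        rw [Real.dist_eq, abs_of_nonneg (by linarith)]; linarith
    exact this.continuous
  have gval : ∀ i w, g i (X w) = Z i w := by
    intro i w
    apply le_antisymm
    · have := ciInf_le (hbd i (X w)) w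
      simpa using this
    · refine le_ciInf fun w' => ?_
      rcases hc w w' with h | h
      · linarith [h i, le_max_right (X w - X w') 0]
      · have : Z i w - Z i w' ≤ X w - X w' := by
          simp only [hXdef, ← Finset.sum_sub_distrib]
          exact Finset.single_le_sum (f := fun j => Z j w - Z j w')
            (fun j _ => by linarith [h j]) (Finset.mem_univ i)
        linarith [le_max_left (X w - X w') 0]
  let k : ℝ → ℝ := fun x => max (x - C) 0 - max (-C - x) 0
  have kmono : Monotone k := by
    intro x y h
    simp only [k]
    gcongr
  have kcont : Continuous k := by fun_prop
  let G : Fin p → ℝ → ℝ := fun i x => g i x + k x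
  have Gmono : ∀ i, Monotone (G i) := fun i => (gmono i).add kmono
  have Gcont : ∀ i, Continuous (G i) := fun i => (gcont i).add kcont
  have Gval : ∀ i w, G i (X w) = Z i w := by
    intro i w
    have := abs_le.1 (hX w)
    have h0 : k (X w) = 0 := by
      simp only [k]
      rw [max_eq_right (by simp only [hXdef]; linarith), max_eq_right (by simp only [hXdef]; linarith)]; simp
    simp only [G, h0, gval, add_zero]
  let s : ℝ → ℝ := fun x => ∑ i, G i x
  have scont : Continuous s := by
    exact continuous_finsetSum _ fun i _ => Gcont i
  have smono : Monotone s := fun x y h => Finset.sum_le_sum fun i _ => Gmono i h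
  have seq : ∀ x, s x = ∑ i, g i x + p * k x := by
    intro x; simp [s, G, Finset.sum_add_distrib]
  have hp1 : (1:ℝ) ≤ p := by exact_mod_cast hp
  have C0 : 0 ≤ C := (abs_nonneg _).trans (hX (Classical.arbitrary ι))
  have ssurj : ∀ y, ∃ x, s x = y := by
    intro y
    refine mem_range_of_exists_le_of_exists_ge scont ?_ ?_
    · set a := |y - ∑ i, g i (-C)|
      refine ⟨-C - a, ?_⟩
      have a0 : 0 ≤ a := abs_nonneg _
      have h1 : ∑ i, g i (-C - a) ≤ ∑ i, g i (-C) :=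
        Finset.sum_le_sum fun i _ => gmono i (by linarith)
      have h2 : k (-C - a) = - a := by
        simp only [k]
        rw [max_eq_right (by linarith), max_eq_left (by linarith)]; ring
      rw [seq, h2]
      have : -a ≤ y - ∑ i, g i (-C) := neg_abs_le _
      nlinarith
    · set a := |y - ∑ i, g i C|
      refine ⟨C + a, ?_⟩
      have a0 : 0 ≤ a := abs_nonneg _
      have h1 : ∑ i, g i C ≤ ∑ i, g i (C + a) :=
        Finset.sum_le_sum fun i _ => gmono i (by linarith)
      have h2 : k (C + a) = a := by
        simp only [k]
        rw [max_eq_left (by linarith), max_eq_right (by linarith)]; ring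
      rw [seq, h2]
      have : y - ∑ i, g i C ≤ a := le_abs_self _
      nlinarith
  choose r hr using ssurj
  have key : ∀ x y, s x = s y → ∀ i, G i x = G i y := by
    have : ∀ x y, x ≤ y → s x = s y → ∀ i, G i x = G i y := by
      intro x y h e i
      exact (Finset.sum_eq_sum_iff_of_le (fun j _ => Gmono j h)).1 e i (Finset.mem_univ i)
    intro x y e i
    rcases le_total x y with h | h
    · exact this x y h e i
    · exact (this y x h e.symm i).symm
  have rmono : Monotone r := by
    intro x y h
    rcases h.eq_or_lt with rfl | h
    · rfl
    by_contra! h'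
    have := smono h'.le
    rw [hr, hr] at this
    linarith
  refine ⟨fun i x => G i (r x), fun i => (Gmono i).comp rmono, fun x => hr x, fun w i => ?_⟩
  change G i (r (X w)) = Z i w
  rw [← Gval i w]
  apply key
  rw [hr]
  exact (Finset.sum_congr rfl fun j _ => Gval j w).symm

lemma integrable_convex_comp {Ω : Type*} [MeasurableSpace Ω] (μ : Measure Ω)
    [IsProbabilityMeasure μ] (W : Ω → ℝ) (hW : Measurable W) (hb : ∃ C, ∀ ω, |W ω| ≤ C)
    (φ : ℝ → ℝ) (hφ : Continuous φ) : Integrable (fun ω => φ (W ω)) μ := by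
  obtain ⟨C, hC⟩ := hb
  obtain ⟨M, hM⟩ := (isCompact_Icc (a := -C) (b := C)).exists_bound_of_continuousOn hφ.continuousOn
  refine Integrable.of_bound (C := M) (hφ.measurable.comp hW).aestronglyMeasurable ?_
  exact Filter.Eventually.of_forall fun ω => hM _ (abs_le.1 (hC ω))

lemma convex_cont {φ : ℝ → ℝ} (h : ConvexOn ℝ Set.univ φ) : Continuous φ :=
  continuousOn_univ.1 (h.continuousOn isOpen_univ)

lemma convex_step {φ : ℝ → ℝ} (h : ConvexOn ℝ Set.univ φ) {lo hi : ℝ} (hlh : lo < hi) :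
    ∃ c : ℝ, (∀ z e, 0 ≤ e → z + e ≤ lo → φ (z + e) ≤ φ z + c * e) ∧
      (∀ z e, 0 ≤ e → hi ≤ z - e → φ (z - e) ≤ φ z - c * e) := by
  refine ⟨(φ hi - φ lo) / (hi - lo), ?_, ?_⟩
  · intro z e he hz
    rcases he.eq_or_lt with rfl | he
    · simp
    have key : (φ (z + e) - φ z) / (z + e - z) ≤ (φ hi - φ lo) / (hi - lo) := by
      have h1 : (φ (z + e) - φ z) / (z + e - z) ≤ (φ hi - φ (z + e)) / (hi - (z + e)) :=
        h.slope_mono_adjacent (Set.mem_univ _) (Set.mem_univ _) (by linarith) (by linarith)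
      rcases hz.eq_or_lt with h2 | h2
      · rwa [h2] at h1 ⊢
      have h3 := h.slope_mono_adjacent (Set.mem_univ (z + e)) (Set.mem_univ hi) h2 hlh
      have h4 := h.slope_mono_adjacent (Set.mem_univ z) (Set.mem_univ lo)
        (show z < z + e by linarith) h2
      exact h4.trans h3
    rw [show z + e - z = e by ring, div_le_iff₀ he] at key
    linarith
  · intro z e he hz
    rcases he.eq_or_lt with rfl | he
    · simp
    have key : (φ hi - φ lo) / (hi - lo) ≤ (φ z - φ (z - e)) / (z - (z - e)) := by
      rcases hz.eq_or_lt with h2 | h2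
      · have := h.slope_mono_adjacent (Set.mem_univ lo) (Set.mem_univ z) hlh
          (show hi < z by linarith)
        rwa [← h2]
      have h3 := h.slope_mono_adjacent (Set.mem_univ lo) (Set.mem_univ (z - e)) hlh h2
      have h4 := h.slope_mono_adjacent (Set.mem_univ hi) (Set.mem_univ z) h2
        (show z - e < z by linarith)
      exact h3.trans h4
    rw [show z - (z - e) = e by ring, le_div_iff₀ he] at key
    linarith

/-- the transfer variable -/
noncomputable def transferH {Ω : Type*} [MeasurableSpace Ω] (μ : Measure Ω) (A B : Set Ω) (δ : ℝ) :
    Ω → ℝ :=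
  fun ω => A.indicator (fun _ => δ * μ.real B) ω - B.indicator (fun _ => δ * μ.real A) ω

section
variable {Ω : Type*} [MeasurableSpace Ω] (μ : Measure Ω) [IsProbabilityMeasure μ]
  {A B : Set Ω} {δ : ℝ}

lemma transferH_swap : transferH μ B A δ = fun ω => - transferH μ A B δ ω := by
  funext ω; simp [transferH]

lemma transferH_meas (hA : MeasurableSet A) (hB : MeasurableSet B) :
    Measurable (transferH μ A B δ) := by
  unfold transferH
  exact (measurable_const.indicator hA).sub (measurable_const.indicator hB)

lemma transferH_bdd (hδ : 0 < δ) (ω : Ω) : |transferH μ A B δ ω| ≤ 2 * δ := by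
  have h1 : μ.real A ≤ 1 := measureReal_le_one
  have h2 : μ.real B ≤ 1 := measureReal_le_one
  have h3 : 0 ≤ μ.real A := measureReal_nonneg
  have h4 : 0 ≤ μ.real B := measureReal_nonneg
  unfold transferH
  classical
  simp only [Set.indicator_apply]
  rw [abs_le]
  split_ifs <;> constructor <;> nlinarith

lemma integral_two (hA : MeasurableSet A) (hB : MeasurableSet B) (x y : ℝ) :
    ∫ ω, (A.indicator (fun _ => x) ω - B.indicator (fun _ => y) ω) ∂μ
      = μ.real A * x - μ.real B * y := by
  rw [integral_sub ((integrable_const x).indicator hA) ((integrable_const y).indicator hB),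
    integral_indicator_const _ hA, integral_indicator_const _ hB]
  simp

lemma transfer_dom (hA : MeasurableSet A) (hB : MeasurableSet B) (hδ : 0 < δ)
    (hA0 : 0 < μ.real A) (hB0 : 0 < μ.real B)
    {lo hi : ℝ} (hlh : lo < hi) (W : Ω → ℝ) (hW : Measurable W) (hb : ∃ C, ∀ ω, |W ω| ≤ C)
    (hWA : ∀ ω ∈ A, W ω + δ ≤ lo) (hWB : ∀ ω ∈ B, hi ≤ W ω - δ) :
    ConcaveDom μ (fun ω => W ω + transferH μ A B δ ω) W ∧
    ∫ ω, (W ω + transferH μ A B δ ω) ^ 2 ∂μ < ∫ ω, (W ω) ^ 2 ∂μ := by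
  classical
  have h1 : μ.real A ≤ 1 := measureReal_le_one
  have h2 : μ.real B ≤ 1 := measureReal_le_one
  have hdisj : ∀ ω, ω ∈ A → ω ∉ B := fun ω ha hb' => by
    linarith [hWA ω ha, hWB ω hb']
  have hWm : Measurable (fun ω => W ω + transferH μ A B δ ω) := hW.add (transferH_meas μ hA hB)
  have hWb : ∃ C, ∀ ω, |W ω + transferH μ A B δ ω| ≤ C := by
    obtain ⟨C, hC⟩ := hb
    exact ⟨C + 2 * δ, fun ω => (abs_add_le _ _).trans (add_le_add (hC ω) (transferH_bdd μ hδ ω))⟩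
  have e1 : δ * μ.real B ≤ δ := by nlinarith
  have e2 : δ * μ.real A ≤ δ := by nlinarith
  have p1 : 0 < δ * μ.real B := by positivity
  have p2 : 0 < δ * μ.real A := by positivity
  -- general comparison
  have gen : ∀ (φ : ℝ → ℝ) (x y : ℝ), Continuous φ →
      (∀ ω ∈ A, φ (W ω + δ * μ.real B) ≤ φ (W ω) + x) →
      (∀ ω ∈ B, φ (W ω - δ * μ.real A) ≤ φ (W ω) - y) →
      ∫ ω, φ (W ω + transferH μ A B δ ω) ∂μ ≤ ∫ ω, φ (W ω) ∂μ + (μ.real A * x - μ.real B * y) := by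
    intro φ x y hφ hx hy
    have i1 := integrable_convex_comp μ _ hWm hWb φ hφ
    have i2 := integrable_convex_comp μ _ hW hb φ hφ
    have i3 : Integrable (fun ω => A.indicator (fun _ => x) ω - B.indicator (fun _ => y) ω) μ :=
      ((integrable_const x).indicator hA).sub ((integrable_const y).indicator hB)
    rw [← integral_two μ hA hB x y, ← integral_add i2 i3]
    refine integral_mono i1 (i2.add i3) fun ω => ?_
    simp only [transferH, Set.indicator_apply, Pi.add_apply]
    by_cases ha : ω ∈ A
    · have hb' := hdisj ω ha
      simpa [ha, hb'] using hx ω ha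
    · by_cases hb' : ω ∈ B
      · have := hy ω hb'
        simpa [ha, hb', sub_eq_add_neg] using this
      · simp [ha, hb']
  constructor
  · intro φ hφ
    obtain ⟨c, hc1, hc2⟩ := convex_step hφ hlh
    have := gen φ (c * (δ * μ.real B)) (c * (δ * μ.real A)) (convex_cont hφ)
      (fun ω h => hc1 _ _ p1.le (by linarith [hWA ω h]))
      (fun ω h => hc2 _ _ p2.le (by linarith [hWB ω h]))
    refine this.trans (le_of_eq ?_)
    ring
  · have := gen (fun x => x ^ 2) (2 * lo * (δ * μ.real B)) (2 * hi * (δ * μ.real A))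
      (by fun_prop)
      (fun ω h => by
        have h' := hWA ω h
        nlinarith)
      (fun ω h => by
        have h' := hWB ω h
        nlinarith)
    have h3 : μ.real A * (2 * lo * (δ * μ.real B)) - μ.real B * (2 * hi * (δ * μ.real A)) < 0 := by
      have : 0 < (hi - lo) * (2 * δ * μ.real A * μ.real B) := by
        have := sub_pos.2 hlh
        positivity
      nlinarith
    linarith

lemma not_eff {p : ℕ} (X : Ω → ℝ) (Z : Fin p → Ω → ℝ) (hZ : IsAlloc X Z)
    (hA : MeasurableSet A) (hB : MeasurableSet B) (hδ : 0 < δ)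
    (hA0 : 0 < μ.real A) (hB0 : 0 < μ.real B) {i j : Fin p}
    {lo hi lo' hi' : ℝ} (hlh : lo < hi) (hlh' : lo' < hi')
    (hiA : ∀ ω ∈ A, Z i ω + δ ≤ lo) (hiB : ∀ ω ∈ B, hi ≤ Z i ω - δ)
    (hjB : ∀ ω ∈ B, Z j ω + δ ≤ lo') (hjA : ∀ ω ∈ A, hi' ≤ Z j ω - δ) :
    ¬ EfficientAlloc μ X Z := by
  classical
  have hij : i ≠ j := by
    rintro rfl
    have : A.Nonempty := by
      by_contra h
      rw [Set.not_nonempty_iff_eq_empty] at h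
      simp [h] at hA0
    have : B.Nonempty := by
      by_contra h
      rw [Set.not_nonempty_iff_eq_empty] at h
      simp [h] at hB0
    obtain ⟨a, ha⟩ := ‹A.Nonempty›
    obtain ⟨b, hb⟩ := ‹B.Nonempty›
    linarith [hiA a ha, hiB b hb, hjB b hb, hjA a ha]
  obtain ⟨hm, hb, hs⟩ := hZ
  have Di := transfer_dom μ hA hB hδ hA0 hB0 hlh (Z i) (hm i) (hb i) hiA hiB
  have Dj := transfer_dom μ hB hA hδ hB0 hA0 hlh' (Z j) (hm j) (hb j) hjB hjA
  unfold EfficientAlloc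
  rw [not_not]
  let Y : Fin p → Ω → ℝ := fun k =>
    if k = i then fun ω => Z k ω + transferH μ A B δ ω
    else if k = j then fun ω => Z k ω + transferH μ B A δ ω else Z k
  have Yi : Y i = fun ω => Z i ω + transferH μ A B δ ω := by simp [Y]
  have Yj : Y j = fun ω => Z j ω + transferH μ B A δ ω := by simp [Y, hij.symm]
  have Yk : ∀ k, k ≠ i → k ≠ j → Y k = Z k := by intro k h1 h2; simp [Y, h1, h2]
  refine ⟨Y, ⟨?_, ?_, ?_⟩, ?_, i, fun x => x ^ 2, (even_two).convexOn_pow, ?_⟩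
  · intro k
    by_cases h1 : k = i
    · subst h1; rw [Yi]; exact (hm k).add (transferH_meas μ hA hB)
    by_cases h2 : k = j
    · subst h2; rw [Yj]; exact (hm k).add (transferH_meas μ hB hA)
    rw [Yk k h1 h2]; exact hm k
  · intro k
    obtain ⟨C, hC⟩ := hb k
    by_cases h1 : k = i
    · subst h1; rw [Yi]
      exact ⟨C + 2 * δ, fun ω => (abs_add_le _ _).trans (add_le_add (hC ω) (transferH_bdd μ hδ ω))⟩
    by_cases h2 : k = j
    · subst h2; rw [Yj]
      exact ⟨C + 2 * δ, fun ω => (abs_add_le _ _).trans (add_le_add (hC ω) (transferH_bdd μ hδ ω))⟩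
    rw [Yk k h1 h2]; exact ⟨C, hC⟩
  · intro ω
    have : ∀ k, Y k ω = Z k ω + ((if k = i then transferH μ A B δ ω else 0)
        - (if k = j then transferH μ A B δ ω else 0)) := by
      intro k
      by_cases h1 : k = i
      · subst h1; simp [Yi, hij]
      by_cases h2 : k = j
      · subst h2; simp [Yj, h1, transferH_swap μ (A := A) (B := B)]
      simp [Yk k h1 h2, h1, h2]
    simp only [this, Finset.sum_add_distrib, Finset.sum_sub_distrib, hs]
    simp
  · intro k
    by_cases h1 : k = i
    · subst h1; rw [Yi]; exact Di.1
    by_cases h2 : k = j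
    · subst h2; rw [Yj]; exact Dj.1
    rw [Yk k h1 h2]; exact fun φ _ => le_rfl
  · rw [Yi]; exact Di.2

lemma comonotone_of_eff {p : ℕ} (hp : 0 < p) (X : Ω → ℝ) (C : ℝ) (hC : ∀ ω, |X ω| ≤ C)
    (Z : Fin p → Ω → ℝ) (hZ : IsAlloc X Z) (hE : EfficientAlloc μ X Z) :
    ∃ f : Fin p → ℝ → ℝ, (∀ i, Monotone (f i)) ∧ (∀ x, ∑ i, f i x = x) ∧
      ∀ i, (fun ω => f i (X ω)) =ᵐ[μ] Z i := by
  classical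
  let W : Ω → (Fin p → ℝ) := fun ω i => Z i ω
  have hW : Measurable W := measurable_pi_lambda _ hZ.1
  let K := (μ.map W).support
  have hK : ∀ᵐ ω ∂μ, W ω ∈ K := by
    have : K ∈ ae (μ.map W) := Measure.support_mem_ae
    exact ae_of_ae_map hW.aemeasurable this
  have pos : ∀ w ∈ K, ∀ r > 0, 0 < μ.real (W ⁻¹' (Metric.ball w r)) := by
    intro w hw r hr
    have := (Measure.mem_support_iff_forall w).1 hw _ (Metric.ball_mem_nhds w hr)
    rw [Measure.map_apply hW Metric.isOpen_ball.measurableSet] at this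
    exact ENNReal.toReal_pos this.ne' (measure_ne_top _ _)
  have near : ∀ w r ω, ω ∈ W ⁻¹' (Metric.ball w r) → ∀ i, |Z i ω - w i| < r := by
    intro w r ω h i
    have : dist (W ω) w < r := h
    have h2 := dist_le_pi_dist (W ω) w i
    rw [Real.dist_eq] at h2
    exact h2.trans_lt this
  have chain : ∀ w ∈ K, ∀ w' ∈ K, ∀ i j, w i < w' i → w' j < w j → False := by
    intro w hw w' hw' i j hi hj
    let r := min (w' i - w i) (w j - w' j) / 8
    have hr : 0 < r := by
      have : 0 < min (w' i - w i) (w j - w' j) := lt_min (by linarith) (by linarith)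
      positivity
    have r1 : 8 * r ≤ w' i - w i := by
      have := min_le_left (w' i - w i) (w j - w' j)
      simp only [r]; linarith
    have r2 : 8 * r ≤ w j - w' j := by
      have := min_le_right (w' i - w i) (w j - w' j)
      simp only [r]; linarith
    refine not_eff μ X Z hZ (A := W ⁻¹' (Metric.ball w r)) (B := W ⁻¹' (Metric.ball w' r)) (δ := r)
      (i := i) (j := j) (hW Metric.isOpen_ball.measurableSet) (hW Metric.isOpen_ball.measurableSet)
      hr (pos w hw r hr) (pos w' hw' r hr) (lo := w i + 2 * r) (hi := w' i - 2 * r)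
      (lo' := w' j + 2 * r) (hi' := w j - 2 * r)
      (by linarith) (by linarith) ?_ ?_ ?_ ?_ hE
    · intro ω h; have := abs_lt.1 (near _ _ _ h i); linarith
    · intro ω h; have := abs_lt.1 (near _ _ _ h i); linarith
    · intro ω h; have := abs_lt.1 (near _ _ _ h j); linarith
    · intro ω h; have := abs_lt.1 (near _ _ _ h j); linarith
  let G := {ω // W ω ∈ K}
  have : Nonempty G := by
    obtain ⟨ω, h⟩ := hK.exists
    exact ⟨⟨ω, h⟩⟩
  obtain ⟨f, hf1, hf2, hf3⟩ := ext_chain (ι := G) hp (fun i ω => Z i ω.1) C (by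
      intro i
      obtain ⟨M, hM⟩ := hZ.2.1 i
      refine ⟨-M, ?_⟩
      rintro _ ⟨ω, rfl⟩
      exact (abs_le.1 (hM ω.1)).1) (by
      intro ω
      rw [hZ.2.2]; exact hC _) (by
      intro ω ω'
      by_contra! h
      obtain ⟨⟨i, hi⟩, ⟨j, hj⟩⟩ := h
      exact chain _ ω'.2 _ ω.2 i j hi hj)
  refine ⟨f, hf1, hf2, fun i => ?_⟩
  filter_upwards [hK] with ω h
  have := hf3 ⟨ω, h⟩ i
  simp only [hZ.2.2] at this
  exact this
end

section
variable {Ω : Type*} [MeasurableSpace Ω] (μ : Measure Ω) [IsProbabilityMeasure μ]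

lemma stoploss_int (U : Ω → ℝ) (hU : Measurable U) (bU : ∃ C, ∀ ω, |U ω| ≤ C) (k : ℝ) :
    Integrable (fun ω => max (U ω - k) 0) μ :=
  integrable_convex_comp μ U hU bU (fun x => max (x - k) 0) (by fun_prop)

lemma stoploss_tendsto (U : Ω → ℝ) (hU : Measurable U) (bU : ∃ C, ∀ ω, |U ω| ≤ C) (a : ℝ) :
    Filter.Tendsto (fun n : ℕ => ((n : ℝ) + 1) * (∫ ω, max (U ω - a) 0 ∂μ
      - ∫ ω, max (U ω - (a + 1 / ((n : ℝ) + 1))) 0 ∂μ)) Filter.atTop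
      (nhds (μ.real (U ⁻¹' Set.Ioi a))) := by
  have hm : MeasurableSet (U ⁻¹' Set.Ioi a) := hU measurableSet_Ioi
  have e : μ.real (U ⁻¹' Set.Ioi a) = ∫ ω, (U ⁻¹' Set.Ioi a).indicator (fun _ => (1:ℝ)) ω ∂μ := by
    rw [integral_indicator_const _ hm]; simp
  rw [e]
  have e2 : ∀ n : ℕ, ((n : ℝ) + 1) * (∫ ω, max (U ω - a) 0 ∂μ
      - ∫ ω, max (U ω - (a + 1 / ((n : ℝ) + 1))) 0 ∂μ) =
      ∫ ω, ((n : ℝ) + 1) * (max (U ω - a) 0 - max (U ω - (a + 1 / ((n : ℝ) + 1))) 0) ∂μ := by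
    intro n
    rw [integral_const_mul, integral_sub (stoploss_int μ U hU bU _) (stoploss_int μ U hU bU _)]
  simp_rw [e2]
  refine tendsto_integral_of_dominated_convergence (fun _ => 1) ?_ (integrable_const 1) ?_ ?_
  · intro n
    exact Measurable.aestronglyMeasurable (by fun_prop)
  · intro n
    refine Filter.Eventually.of_forall fun ω => ?_
    have hn : (0:ℝ) < (n:ℝ) + 1 := by positivity
    have hn' : (0:ℝ) < 1 / ((n:ℝ) + 1) := by positivity
    have h1 : 0 ≤ max (U ω - a) 0 - max (U ω - (a + 1 / ((n : ℝ) + 1))) 0 := by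
      rw [sub_nonneg]; exact max_le_max (by linarith) le_rfl
    have h2 : max (U ω - a) 0 - max (U ω - (a + 1 / ((n : ℝ) + 1))) 0 ≤ 1 / ((n:ℝ) + 1) := by
      rw [sub_le_iff_le_add]
      apply max_le
      · linarith [le_max_left (U ω - (a + 1 / ((n : ℝ) + 1))) 0]
      · linarith [le_max_right (U ω - (a + 1 / ((n : ℝ) + 1))) 0]
    rw [Real.norm_eq_abs, abs_of_nonneg (mul_nonneg hn.le h1)]
    calc _ ≤ ((n:ℝ) + 1) * (1 / ((n:ℝ) + 1)) := by gcongr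
      _ = 1 := by field_simp
  · refine Filter.Eventually.of_forall fun ω => ?_
    by_cases h : a < U ω
    · have : ω ∈ U ⁻¹' Set.Ioi a := h
      rw [Set.indicator_of_mem this]
      apply tendsto_const_nhds.congr'
      have := (tendsto_one_div_add_atTop_nhds_zero_nat (𝕜 := ℝ)).eventually_lt_const (sub_pos.2 h)
      filter_upwards [this] with n hn
      have hn' : (0:ℝ) < (n:ℝ) + 1 := by positivity
      rw [max_eq_left (by linarith), max_eq_left (by linarith)]
      field_simp
      ring
    · have h' : ω ∉ U ⁻¹' Set.Ioi a := h
      rw [Set.indicator_of_notMem h']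
      push Not at h
      apply tendsto_const_nhds.congr
      intro n
      have hn' : (0:ℝ) < 1 / ((n:ℝ) + 1) := by positivity
      rw [max_eq_right (by linarith), max_eq_right (by linarith)]
      simp

lemma law_eq (U V : Ω → ℝ) (hU : Measurable U) (bU : ∃ C, ∀ ω, |U ω| ≤ C)
    (hV : Measurable V) (bV : ∃ C, ∀ ω, |V ω| ≤ C)
    (h : ∀ k, ∫ ω, max (U ω - k) 0 ∂μ = ∫ ω, max (V ω - k) 0 ∂μ) :
    μ.map U = μ.map V := by
  have := Measure.isProbabilityMeasure_map (μ := μ) hU.aemeasurable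
  have := Measure.isProbabilityMeasure_map (μ := μ) hV.aemeasurable
  refine Measure.ext_of_Iic _ _ fun a => ?_
  have h1 := stoploss_tendsto μ U hU bU a
  have h2 := stoploss_tendsto μ V hV bV a
  simp_rw [h] at h1
  have h3 := tendsto_nhds_unique h1 h2
  rw [Measure.map_apply hU measurableSet_Iic, Measure.map_apply hV measurableSet_Iic]
  have c1 : U ⁻¹' Set.Iic a = (U ⁻¹' Set.Ioi a)ᶜ := by ext; simp
  have c2 : V ⁻¹' Set.Iic a = (V ⁻¹' Set.Ioi a)ᶜ := by ext; simp
  rw [c1, c2, prob_compl_eq_one_sub (hU measurableSet_Ioi),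
    prob_compl_eq_one_sub (hV measurableSet_Ioi)]
  congr 1
  exact (measureReal_eq_measureReal_iff).1 h3

lemma eff_of_comonotone {p : ℕ} (X : Ω → ℝ) (C : ℝ) (hC0 : 0 ≤ C)
    (hXm : Measurable X) (hC : ∀ ω, X ω ∈ Set.Icc (-C) C)
    (F : Set.Icc (-C) C → Fin p → ℝ) (Fc : ∀ i, Continuous fun x => F x i)
    (Fm : ∀ i, Monotone fun x => F x i) (Fs : ∀ x, ∑ i, F x i = x) :
    IsAlloc X (fun i ω => F ⟨X ω, hC ω⟩ i) ∧
      EfficientAlloc μ X (fun i ω => F ⟨X ω, hC ω⟩ i) := by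
  set Z : Fin p → Ω → ℝ := fun i ω => F ⟨X ω, hC ω⟩ i with hZdef
  have hlo : -C ∈ Set.Icc (-C) C := ⟨le_rfl, by linarith⟩
  have hhi : C ∈ Set.Icc (-C) C := ⟨by linarith, le_rfl⟩
  have Zlo : ∀ i ω, F ⟨-C, hlo⟩ i ≤ Z i ω := fun i ω => Fm i (hC ω).1
  have Zhi : ∀ i ω, Z i ω ≤ F ⟨C, hhi⟩ i := fun i ω => Fm i (hC ω).2
  have hZ : IsAlloc X Z := by
    refine ⟨fun i => (Fc i).measurable.comp (hXm.subtype_mk), fun i => ?_, fun ω => Fs _⟩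
    refine ⟨max |F ⟨-C, hlo⟩ i| |F ⟨C, hhi⟩ i|, fun ω => ?_⟩
    exact abs_le_max_abs_abs (Zlo i ω) (Zhi i ω)
  refine ⟨hZ, ?_⟩
  rintro ⟨Y, hY, hdom, i, φ, hφ, hlt⟩
  have cvx : ∀ k : ℝ, ConvexOn ℝ Set.univ (fun x : ℝ => max (x - k) 0) := by
    intro k
    exact ((convexOn_id convex_univ).sub (concaveOn_const k convex_univ)).sup
      (convexOn_const 0 convex_univ)
  have intY : ∀ i, Integrable (Y i) μ := fun i =>
    integrable_convex_comp μ (Y i) (hY.1 i) (hY.2.1 i) (fun x => x) continuous_id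
  have intZ : ∀ i, Integrable (Z i) μ := fun i =>
    integrable_convex_comp μ (Z i) (hZ.1 i) (hZ.2.1 i) (fun x => x) continuous_id
  have mean : ∀ i, ∫ ω, Y i ω ∂μ = ∫ ω, Z i ω ∂μ := by
    intro i
    apply le_antisymm
    · exact hdom i (fun x => x) (convexOn_id convex_univ)
    · have := hdom i (fun x => -x) (concaveOn_id convex_univ).neg
      rw [integral_neg, integral_neg] at this
      linarith
  have eqF : ∀ (t : Set.Icc (-C) C) i,
      ∫ ω, max (Y i ω - F t i) 0 ∂μ = ∫ ω, max (Z i ω - F t i) 0 ∂μ := by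
    intro t
    have le : ∀ i ∈ Finset.univ, ∫ ω, max (Y i ω - F t i) 0 ∂μ ≤ ∫ ω, max (Z i ω - F t i) 0 ∂μ :=
      fun i _ => hdom i _ (cvx _)
    have s1 : ∑ i, ∫ ω, max (Z i ω - F t i) 0 ∂μ = ∫ ω, max (X ω - t) 0 ∂μ := by
      rw [← integral_finsetSum _ fun i _ => stoploss_int μ _ (hZ.1 i) (hZ.2.1 i) _]
      congr 1
      funext ω
      have e : ∑ i, (Z i ω - F t i) = X ω - t := by
        rw [Finset.sum_sub_distrib, hZ.2.2, Fs]
      rcases le_total (X ω) t with h | h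
      · rw [max_eq_right (by linarith)]
        apply Finset.sum_eq_zero
        intro i _
        have : Z i ω ≤ F t i := Fm i (show (⟨X ω, hC ω⟩ : Set.Icc (-C) C) ≤ t from h)
        exact max_eq_right (by linarith)
      · rw [max_eq_left (by linarith), ← e]
        apply Finset.sum_congr rfl
        intro i _
        have : F t i ≤ Z i ω := Fm i (show t ≤ (⟨X ω, hC ω⟩ : Set.Icc (-C) C) from h)
        exact max_eq_left (by linarith)
    have s2 : ∫ ω, max (X ω - t) 0 ∂μ ≤ ∑ i, ∫ ω, max (Y i ω - F t i) 0 ∂μ := by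
      rw [← integral_finsetSum _ fun i _ => stoploss_int μ _ (hY.1 i) (hY.2.1 i) _]
      refine integral_mono (stoploss_int μ X hXm ⟨C, fun ω => abs_le.2 (hC ω)⟩ _)
        (integrable_finsetSum _ fun i _ => stoploss_int μ _ (hY.1 i) (hY.2.1 i) _) fun ω => ?_
      apply max_le
      · rw [← hY.2.2 ω, ← Fs t, ← Finset.sum_sub_distrib]
        exact Finset.sum_le_sum fun i _ => le_max_left _ _
      · exact Finset.sum_nonneg fun i _ => le_max_right _ _
    have s3 := (Finset.sum_le_sum le).antisymm (s1.trans_le s2)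
    intro i
    exact (Finset.sum_eq_sum_iff_of_le le).1 s3 i (Finset.mem_univ i)
  -- put-call parity
  have parity : ∀ (U : Ω → ℝ) (k : ℝ), Measurable U → (∃ C, ∀ ω, |U ω| ≤ C) → Integrable U μ →
      ∫ ω, max (U ω - k) 0 ∂μ = ∫ ω, U ω ∂μ - k + ∫ ω, max (k - U ω) 0 ∂μ := by
    intro U k hU bU iU
    have i1 : Integrable (fun ω => max (k - U ω) 0) μ :=
      integrable_convex_comp μ U hU bU (fun x => max (k - x) 0) (by fun_prop)
    have : ∀ ω, max (U ω - k) 0 = U ω - k + max (k - U ω) 0 := by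
      intro ω
      rcases le_total (U ω) k with h | h
      · rw [max_eq_right (by linarith), max_eq_left (by linarith)]; ring
      · rw [max_eq_left (by linarith), max_eq_right (by linarith)]; ring
    simp_rw [this]
    have h2 : Integrable (fun ω => U ω - k) μ := iU.sub (integrable_const k)
    rw [integral_add h2 i1, integral_sub iU (integrable_const k)]
    simp
  have eqk : ∀ k, ∫ ω, max (Y i ω - k) 0 ∂μ = ∫ ω, max (Z i ω - k) 0 ∂μ := by
    intro k
    by_cases h1 : k < F ⟨-C, hlo⟩ i
    · set a := F ⟨-C, hlo⟩ i with ha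
      rw [parity (Y i) k (hY.1 i) (hY.2.1 i) (intY i), parity (Z i) k (hZ.1 i) (hZ.2.1 i) (intZ i),
        mean i]
      have z0 : ∀ c ≤ a, ∫ ω, max (c - Z i ω) 0 ∂μ = 0 := by
        intro c hc
        have : ∀ ω, max (c - Z i ω) 0 = 0 := fun ω => max_eq_right (by linarith [Zlo i ω])
        simp [this]
      have y0 : ∫ ω, max (a - Y i ω) 0 ∂μ = 0 := by
        have := eqF ⟨-C, hlo⟩ i
        rw [← ha, parity (Y i) a (hY.1 i) (hY.2.1 i) (intY i),
          parity (Z i) a (hZ.1 i) (hZ.2.1 i) (intZ i), mean i, z0 a le_rfl] at this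
        linarith
      have y1 : ∫ ω, max (k - Y i ω) 0 ∂μ ≤ ∫ ω, max (a - Y i ω) 0 ∂μ := by
        refine integral_mono
          (integrable_convex_comp μ (Y i) (hY.1 i) (hY.2.1 i) (fun x => max (k - x) 0) (by fun_prop))
          (integrable_convex_comp μ (Y i) (hY.1 i) (hY.2.1 i) (fun x => max (a - x) 0) (by fun_prop))
          fun ω => ?_
        exact max_le_max (by linarith) le_rfl
      have y2 : 0 ≤ ∫ ω, max (k - Y i ω) 0 ∂μ := integral_nonneg fun ω => le_max_right _ _
      rw [z0 k h1.le]
      linarith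
    by_cases h2 : F ⟨C, hhi⟩ i < k
    · set b := F ⟨C, hhi⟩ i with hb
      have z0 : ∀ c, b ≤ c → ∫ ω, max (Z i ω - c) 0 ∂μ = 0 := by
        intro c hc
        have : ∀ ω, max (Z i ω - c) 0 = 0 := fun ω => max_eq_right (by linarith [Zhi i ω])
        simp [this]
      have y0 := eqF ⟨C, hhi⟩ i
      rw [← hb, z0 b le_rfl] at y0
      have y1 : ∫ ω, max (Y i ω - k) 0 ∂μ ≤ ∫ ω, max (Y i ω - b) 0 ∂μ := by
        refine integral_mono (stoploss_int μ _ (hY.1 i) (hY.2.1 i) _)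
          (stoploss_int μ _ (hY.1 i) (hY.2.1 i) _) fun ω => ?_
        exact max_le_max (by linarith) le_rfl
      have y2 : 0 ≤ ∫ ω, max (Y i ω - k) 0 ∂μ := integral_nonneg fun ω => le_max_right _ _
      rw [z0 k h2.le]
      linarith
    push Not at h1 h2
    have : PreconnectedSpace (Set.Icc (-C) C) :=
      Subtype.preconnectedSpace isPreconnected_Icc
    obtain ⟨t, ht⟩ := mem_range_of_exists_le_of_exists_ge (Fc i) ⟨_, h1⟩ ⟨_, h2⟩
    simp only at ht
    rw [← ht]
    exact eqF t i
  have law := law_eq μ (Y i) (Z i) (hY.1 i) (hY.2.1 i) (hZ.1 i) (hZ.2.1 i) eqk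
  have m : ∀ ν : Measure ℝ, AEStronglyMeasurable φ ν :=
    fun ν => (convex_cont hφ).aestronglyMeasurable
  have q1 := integral_map (μ := μ) (hY.1 i).aemeasurable (m _)
  have q2 := integral_map (μ := μ) (hZ.1 i).aemeasurable (m _)
  rw [← q1, ← q2, law] at hlt
  exact lt_irrefl _ hlt
end

/-- comonotone sharing rules on `[-C, C]` -/
def sharing (p : ℕ) (C : ℝ) : Set (BoundedContinuousFunction (Set.Icc (-C) C) (Fin p → ℝ)) :=
  {F | (∀ i, Monotone fun x => F x i) ∧ ∀ x, ∑ i, F x i = (x : ℝ)}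

lemma sharing_lip {p : ℕ} {C : ℝ} (F : Set.Icc (-C) C → Fin p → ℝ)
    (h1 : ∀ i, Monotone fun x => F x i) (h2 : ∀ x, ∑ i, F x i = (x : ℝ)) :
    LipschitzWith 1 F := by
  have key : ∀ x y : Set.Icc (-C) C, x ≤ y → ∀ i, |F x i - F y i| ≤ |(x : ℝ) - y| := by
    intro x y hxy i
    have h3 : F x i ≤ F y i := h1 i hxy
    have h4 : (x : ℝ) ≤ y := hxy
    have h5 : F y i - F x i ≤ y - x := by
      rw [← h2, ← h2, ← Finset.sum_sub_distrib]
      exact Finset.single_le_sum (f := fun j => F y j - F x j)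
        (fun j _ => sub_nonneg.2 (h1 j hxy)) (Finset.mem_univ i)
    rw [abs_sub_comm, abs_of_nonneg (by linarith), abs_sub_comm, abs_of_nonneg (by linarith)]
    exact h5
  refine LipschitzWith.of_dist_le_mul fun x y => ?_
  rw [NNReal.coe_one, one_mul]
  refine (dist_pi_le_iff dist_nonneg).2 fun i => ?_
  rw [Subtype.dist_eq, Real.dist_eq, Real.dist_eq]
  rcases le_total x y with h | h
  · exact key x y h i
  · rw [abs_sub_comm, abs_sub_comm (x : ℝ)]; exact key y x h i

lemma sharing_compact (p : ℕ) (C : ℝ) (z : Set.Icc (-C) C) :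
    IsCompact (sharing p C ∩ {F | F z = 0}) := by
  have ev : ∀ (x : Set.Icc (-C) C),
      Continuous fun F : BoundedContinuousFunction (Set.Icc (-C) C) (Fin p → ℝ) => F x :=
    fun x => continuous_eval_const x
  have evi : ∀ (x : Set.Icc (-C) C) (i : Fin p),
      Continuous fun F : BoundedContinuousFunction (Set.Icc (-C) C) (Fin p → ℝ) => F x i :=
    fun x i => (continuous_apply i).comp (ev x)
  refine BoundedContinuousFunction.arzela_ascoli₂ (Metric.closedBall 0 (2 * C))
    (isCompact_closedBall _ _) _ ?_ ?_ ?_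
  · refine IsClosed.inter ?_ (isClosed_eq (ev z) continuous_const)
    have : sharing p C = (⋂ i, ⋂ x, ⋂ y, ⋂ (_ : x ≤ y), {F | F x i ≤ F y i}) ∩
        ⋂ x : Set.Icc (-C) C, {F | ∑ i, F x i = (x : ℝ)} := by
      ext F
      simp only [sharing, Monotone, Set.mem_setOf_eq, Set.mem_inter_iff, Set.mem_iInter]
    rw [this]
    refine IsClosed.inter ?_ ?_
    · refine isClosed_iInter fun i => isClosed_iInter fun x => isClosed_iInter fun y =>
        isClosed_iInter fun _ => isClosed_le (evi x i) (evi y i)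
    · exact isClosed_iInter fun x =>
        isClosed_eq (continuous_finsetSum _ fun i _ => evi x i) continuous_const
  · rintro F x ⟨⟨h1, h2⟩, h3⟩
    have := (sharing_lip F h1 h2).dist_le_mul x z
    rw [show F z = 0 from h3, NNReal.coe_one, one_mul, Subtype.dist_eq, Real.dist_eq] at this
    refine this.trans ?_
    have hx := x.2
    have hz := z.2
    rw [abs_le]
    constructor <;> linarith [hx.1, hx.2, hz.1, hz.2]
  · refine (LipschitzWith.uniformEquicontinuous _ 1 fun F => ?_).equicontinuous
    exact sharing_lip F.1 F.2.1.1 F.2.1.2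

/-- zero-sum constants form a closed set -/
lemma zero_sum_closed {Ω : Type*} [MeasurableSpace Ω] (μ : Measure Ω) [IsProbabilityMeasure μ]
    (p : ℕ) :
    IsClosed {T : Fin p → Lp ℝ ⊤ μ | ∃ lam : Fin p → ℝ, (∑ i, lam i) = 0 ∧
              ∀ i, (T i : Ω → ℝ) =ᵐ[μ] fun _ => lam i} := by
  let L : (Fin p → ℝ) →ₗ[ℝ] (Fin p → Lp ℝ ⊤ μ) :=
    LinearMap.pi fun i => (Lp.constₗ ⊤ μ ℝ).comp (LinearMap.proj i)
  let s : (Fin p → ℝ) →ₗ[ℝ] ℝ := ∑ i, LinearMap.proj i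
  have : {T : Fin p → Lp ℝ ⊤ μ | ∃ lam : Fin p → ℝ, (∑ i, lam i) = 0 ∧
              ∀ i, (T i : Ω → ℝ) =ᵐ[μ] fun _ => lam i} = (s.ker.map L : Set (Fin p → Lp ℝ ⊤ μ)) := by
    ext T
    simp only [Set.mem_setOf_eq, SetLike.mem_coe, Submodule.mem_map, LinearMap.mem_ker]
    refine exists_congr fun lam => and_congr (by simp [s]) ?_
    constructor
    · intro h
      funext i
      refine Lp.ext ?_
      exact (Lp.coeFn_const (p := ⊤) (μ := μ) (lam i)).trans (h i).symm
    · rintro rfl i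
      exact Lp.coeFn_const (p := ⊤) (μ := μ) (lam i)
  rw [this]
  exact Submodule.closed_of_finiteDimensional _


/-- the set of efficient allocations of X, viewed in (L^∞)^p, is
convex and is the sum of the subspace of zero-sum constant translations and a
compact set; in particular it is closed. -/
theorem stmt14 {Ω : Type*} [MeasurableSpace Ω] (μ : Measure Ω) [IsProbabilityMeasure μ]
    (hna : Nonatomic μ) {p : ℕ}
    (X : Ω → ℝ) (hXm : Measurable X) (hXb : ∃ C, ∀ ω, |X ω| ≤ C)
    (S : Set (Fin p → Lp ℝ ⊤ μ))
    (hS : S = {Y | ∃ Z : Fin p → Ω → ℝ, IsAlloc X Z ∧ EfficientAlloc μ X Z ∧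
      ∀ i, (Y i : Ω → ℝ) =ᵐ[μ] Z i}) :
    Convex ℝ S ∧ IsClosed S ∧
      ∃ A₀ : Set (Fin p → Lp ℝ ⊤ μ), IsCompact A₀ ∧
        S = {T : Fin p → Lp ℝ ⊤ μ | ∃ lam : Fin p → ℝ, (∑ i, lam i) = 0 ∧
              ∀ i, (T i : Ω → ℝ) =ᵐ[μ] fun _ => lam i} + A₀ := by

  classical
  rcases Nat.eq_zero_or_pos p with rfl | hp
  · have hsub : Subsingleton (Fin 0 → Lp ℝ ⊤ μ) := inferInstance
    refine ⟨?_, S.toFinite.isClosed, S, S.toFinite.isCompact, ?_⟩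
    · intro x hx y hy a b _ _ _
      rwa [Subsingleton.elim (a • x + b • y) x]
    · ext Y
      constructor
      · intro h
        refine Set.mem_add.2 ⟨0, ⟨0, by simp, fun i => i.elim0⟩, Y, h, Subsingleton.elim _ _⟩
      · intro h
        obtain ⟨a, _, b, hb, _⟩ := Set.mem_add.1 h
        rwa [Subsingleton.elim Y b]
  obtain ⟨C, hC'⟩ := hXb
  obtain ⟨ω₀⟩ : Nonempty Ω := nonempty_of_isProbabilityMeasure μ
  have hC0 : 0 ≤ C := (abs_nonneg _).trans (hC' ω₀)
  have hC : ∀ ω, X ω ∈ Set.Icc (-C) C := fun ω => abs_le.1 (hC' ω)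
  let Xc : Ω → Set.Icc (-C) C := fun ω => ⟨X ω, hC ω⟩
  have hXc : Measurable Xc := hXm.subtype_mk
  have hS2 : S = {Y | ∃ F ∈ sharing p C, ∀ i, (Y i : Ω → ℝ) =ᵐ[μ] fun ω => F (Xc ω) i} := by
    rw [hS]
    ext Y
    constructor
    · rintro ⟨Z, hZ, hE, hY⟩
      obtain ⟨f, f1, f2, f3⟩ := comonotone_of_eff μ hp X C hC' Z hZ hE
      have m1 : ∀ i, Monotone fun x : Set.Icc (-C) C => f i x := fun i x y h => f1 i h
      let F : C(Set.Icc (-C) C, Fin p → ℝ) := ⟨fun x i => f i x,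
        (sharing_lip (fun (x : Set.Icc (-C) C) i => f i x) m1 (fun x => f2 x)).continuous⟩
      refine ⟨BoundedContinuousFunction.mkOfCompact F, ⟨m1, fun x => f2 x⟩, fun i => ?_⟩
      exact (hY i).trans (f3 i).symm
    · rintro ⟨F, ⟨F1, F2⟩, hY⟩
      have := eff_of_comonotone μ X C hC0 hXm hC F
        (fun i => (continuous_apply i).comp F.continuous) F1 F2
      exact ⟨_, this.1, this.2, hY⟩
  have hconv : Convex ℝ S := by
    rw [hS2]
    rintro Y ⟨F, ⟨F1, F2⟩, hF⟩ Y' ⟨F', ⟨F1', F2'⟩, hF'⟩ a b ha hb hab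
    refine ⟨a • F + b • F', ⟨fun i x y h => ?_, fun x => ?_⟩, fun i => ?_⟩
    · have h1 := F1 i h
      have h2 := F1' i h
      simp only [BoundedContinuousFunction.coe_add, BoundedContinuousFunction.coe_smul,
        Pi.add_apply, Pi.smul_apply, smul_eq_mul] at h1 h2 ⊢
      gcongr
    · simp only [BoundedContinuousFunction.coe_add, BoundedContinuousFunction.coe_smul,
        Pi.add_apply, Pi.smul_apply, smul_eq_mul, Finset.sum_add_distrib, ← Finset.mul_sum, F2, F2']
      rw [← add_mul, hab, one_mul]
    · filter_upwards [hF i, hF' i, Lp.coeFn_add (a • Y i) (b • Y' i), Lp.coeFn_smul a (Y i),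
        Lp.coeFn_smul b (Y' i)] with ω h1 h2 h3 h4 h5
      simp only [Pi.add_apply, Pi.smul_apply, smul_eq_mul] at h3 h4 h5 ⊢
      rw [h3, h4, h5, h1, h2]
      simp
  let z : Set.Icc (-C) C := ⟨0, by constructor <;> linarith⟩
  have mem : ∀ (F : BoundedContinuousFunction (Set.Icc (-C) C) (Fin p → ℝ)) (i : Fin p),
      MemLp (fun ω => F (Xc ω) i) ⊤ μ := by
    intro F i
    refine memLp_top_of_bound (C := ‖F‖) ?_ (Filter.Eventually.of_forall fun ω => ?_)
    · exact (((continuous_apply i).comp F.continuous).measurable.comp hXc).aestronglyMeasurable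
    · exact (norm_le_pi_norm (F (Xc ω)) i).trans (F.norm_coe_le_norm _)
  let Φ : BoundedContinuousFunction (Set.Icc (-C) C) (Fin p → ℝ) → (Fin p → Lp ℝ ⊤ μ) :=
    fun F i => (mem F i).toLp
  have hΦ : Continuous Φ := by
    refine (LipschitzWith.of_dist_le_mul (K := 1) fun F G => ?_).continuous
    rw [NNReal.coe_one, one_mul]
    refine (dist_pi_le_iff dist_nonneg).2 fun i => ?_
    rw [dist_eq_norm, ← MemLp.toLp_sub]
    have := Lp.norm_le_of_ae_bound (p := ⊤) (μ := μ)
      (f := ((mem F i).sub (mem G i)).toLp) (C := dist F G) dist_nonneg (by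
        filter_upwards [((mem F i).sub (mem G i)).coeFn_toLp] with ω h
        rw [h]
        simp only [Pi.sub_apply]
        rw [← dist_eq_norm]
        exact (dist_le_pi_dist _ _ i).trans (F.dist_coe_le_dist _))
    simpa using this
  have hA : IsCompact (Φ '' (sharing p C ∩ {F | F z = 0})) := (sharing_compact p C z).image hΦ
  have hsum : S = {T : Fin p → Lp ℝ ⊤ μ | ∃ lam : Fin p → ℝ, (∑ i, lam i) = 0 ∧
              ∀ i, (T i : Ω → ℝ) =ᵐ[μ] fun _ => lam i} + Φ '' (sharing p C ∩ {F | F z = 0}) := by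
    rw [hS2]
    ext Y
    rw [Set.mem_add]
    constructor
    · rintro ⟨F, ⟨F1, F2⟩, hF⟩
      let G := F - BoundedContinuousFunction.const _ (F z)
      have hG : ∀ x i, G x i = F x i - F z i := fun x i => rfl
      refine ⟨Y - Φ G, ⟨F z, by rw [F2], fun i => ?_⟩, Φ G, ⟨G, ⟨⟨?_, ?_⟩, ?_⟩, rfl⟩, by simp⟩
      · filter_upwards [hF i, Lp.coeFn_sub (Y i) (Φ G i), (mem G i).coeFn_toLp] with ω h1 h2 h3
        have h2' : ((Y - Φ G) i : Ω → ℝ) ω = (Y i : Ω → ℝ) ω - (Φ G i : Ω → ℝ) ω := h2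
        have h3' : (Φ G i : Ω → ℝ) ω = G (Xc ω) i := h3
        rw [h2', h3', h1, hG]
        ring
      · intro i x y h
        have := F1 i h
        simp only [hG] at this ⊢
        linarith
      · intro x
        simp only [hG, Finset.sum_sub_distrib, F2]
        simp [z]
      · funext i
        simp [hG]
    · rintro ⟨T, ⟨lam, hl, hT⟩, _, ⟨G, ⟨⟨G1, G2⟩, -⟩, rfl⟩, rfl⟩
      have hG : ∀ x i, (G + BoundedContinuousFunction.const (Set.Icc (-C) C) lam) x i = G x i + lam i :=
        fun x i => rfl
      refine ⟨G + BoundedContinuousFunction.const (Set.Icc (-C) C) lam, ⟨?_, ?_⟩, fun i => ?_⟩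
      · intro i x y h
        have := G1 i h
        simp only [hG] at this ⊢
        linarith
      · intro x
        simp only [hG, Finset.sum_add_distrib, G2, hl, add_zero]
      · filter_upwards [hT i, Lp.coeFn_add (T i) (Φ G i), (mem G i).coeFn_toLp] with ω h1 h2 h3
        have h2' : ((T + Φ G) i : Ω → ℝ) ω = (T i : Ω → ℝ) ω + (Φ G i : Ω → ℝ) ω := h2
        have h3' : (Φ G i : Ω → ℝ) ω = G (Xc ω) i := h3
        rw [h2', h3', h1, hG]
        ring
  refine ⟨hconv, ?_, _, hA, hsum⟩
  rw [hsum]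
  exact (zero_sum_closed μ p).add_right_of_isCompact hA
end
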